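/- Let V be a MOSVA and W a V-bimodule, both satisfying the pole-order condition. Let u_1,…,u_m ∈ V and let f ∈ W̃_{z_{m+1},…,z_{m+n}} be such that Y_W^L(u_1,z_1)⋯Y_W^L(u_m,z_m)f(z_{m+1},…,z_{m+n}) converges absolutely to a \overline{W}-valued rational function for every (z_1,…,z_{m+n}) ∈ F_{m+n}ℂ with |z_1| > ⋯ > |z_m| > |z_i| (i = m+1,…,m+n). Then the series Y_W^L(Y_V(u_1,z_1−ζ)⋯Y_V(u_m,z_m−ζ)𝟏, ζ)f(z_{m+1},…,z_{m+n}) also converges absolutely to the same \overline{W}-valued rational function whenever (z_1,…,z_{m+n}) ∈ F_{m+n}ℂ, |ζ| > |z_1−ζ| + |z_i| (i = m+1,…,m+n) and |z_1−ζ| > ⋯ > |z_m−ζ|, and E(Y_W^L(u_1,z_1)⋯Y_W^L(u_m,z_m)f(z_{m+1},…,z_{m+n})) = E(Y_W^L(Y_V(u_1,z_1−ζ)⋯Y_V(u_m,z_m−ζ)𝟏,ζ)f(z_{m+1},…,z_{m+n})) as elements of W̃_{z_1,…,z_{m+n}}. -/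

import Mathlib

set_option autoImplicit false
set_option maxHeartbeats 1000000

open scoped BigOperators

noncomputable section

namespace VA

/-- Absolute convergence of a series of complex numbers indexed by `ι` to the sum `s`. -/
def AbsConvTo {ι : Type*} (f : ι → ℂ) (s : ℂ) : Prop :=
  Summable (fun i => ‖f i‖) ∧ HasSum f s

/-- The configuration-space condition: the entries of `z` are pairwise distinct. -/
def Conf {ι : Type*} (z : ι → ℂ) : Prop := ∀ i j : ι, i ≠ j → z i ≠ z j

/-- `‖z 0‖ > ‖z 1‖ > ⋯ > ‖z (n-1)‖`. -/
def Ordered {n : ℕ} (z : Fin n → ℂ) : Prop := ∀ i j : Fin n, i < j → ‖z j‖ < ‖z i‖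

/-- `‖z 0‖ > ‖z 1‖ > ⋯ > ‖z (n-1)‖ > 0`. -/
def OrderedPos {n : ℕ} (z : Fin n → ℂ) : Prop := Ordered z ∧ ∀ i, 0 < ‖z i‖

/-- A rational function in the variables `z i`, `i : ι`, whose only possible poles are
at `z i = 0` and on the diagonals `z i = z j` (`i ≠ j`); it is recorded as a numerator
polynomial together with the orders of the poles. -/
structure RatFn (ι : Type*) [Fintype ι] [DecidableEq ι] where
  num : MvPolynomial ι ℂ
  a : ι → ℕ
  b : ι → ι → ℕ

def RatFn.eval {ι : Type*} [Fintype ι] [DecidableEq ι] (R : RatFn ι) (z : ι → ℂ) : ℂ :=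
  MvPolynomial.eval z R.num /
    ((∏ i, z i ^ R.a i) * ∏ q ∈ Finset.univ.offDiag, (z q.1 - z q.2) ^ R.b q.1 q.2)

/-- A rational function in the variables `z i`, `i : ι`, whose only possible poles are
on the diagonals `z i = z j` (`i ≠ j`). -/
structure DiagRatFn (ι : Type*) [Fintype ι] [DecidableEq ι] where
  num : MvPolynomial ι ℂ
  b : ι → ι → ℕ

def DiagRatFn.eval {ι : Type*} [Fintype ι] [DecidableEq ι] (R : DiagRatFn ι) (z : ι → ℂ) : ℂ :=
  MvPolynomial.eval z R.num / ∏ q ∈ Finset.univ.offDiag, (z q.1 - z q.2) ^ R.b q.1 q.2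

/-- A linear functional belongs to the graded dual iff its restriction to all but
finitely many homogeneous components vanishes. -/
def InGradedDual {ι : Type*} {M : Type*} [AddCommGroup M] [Module ℂ M]
    (proj : ι → M →ₗ[ℂ] M) (φ : M →ₗ[ℂ] ℂ) : Prop :=
  (Function.support fun i => φ ∘ₗ proj i).Finite

/-- Iterated application: `compApply n f w = f 0 (f 1 (⋯ (f (n-1) w)))`. -/
def compApply {M : Type*} : (n : ℕ) → (Fin n → (M → M)) → M → M
  | 0, _, w => w
  | n+1, f, w => f 0 (compApply n (fun i => f i.succ) w)

section Graded

variable (W : Type*) [AddCommGroup W] [Module ℂ W]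

/-- A `ℂ`-grading of `W`, recorded via the projections onto the homogeneous
subspaces, whose weights have lower-bounded real parts. -/
structure CGrading where
  proj : ℂ → W →ₗ[ℂ] W
  proj_comp : ∀ m n : ℂ, proj m ∘ₗ proj n = if m = n then proj n else 0
  proj_finite : ∀ w : W, (Function.support fun n => proj n w).Finite
  proj_sum : ∀ w : W, (∑ᶠ n : ℂ, proj n w) = w
  lower_bound : ∃ B : ℝ, ∀ n : ℂ, n.re < B → proj n = 0

/-- A `ℤ`-grading of `V` with lower-bounded weights. -/
structure ZGrading where
  proj : ℤ → W →ₗ[ℂ] W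
  proj_comp : ∀ m n : ℤ, proj m ∘ₗ proj n = if m = n then proj n else 0
  proj_finite : ∀ w : W, (Function.support fun n => proj n w).Finite
  proj_sum : ∀ w : W, (∑ᶠ n : ℤ, proj n w) = w
  lower_bound : ∃ B : ℤ, ∀ n : ℤ, n < B → proj n = 0

variable {W}

/-- The grading operator `d` of a `ℂ`-graded space. -/
def CGrading.d (G : CGrading W) (w : W) : W := ∑ᶠ n : ℂ, n • G.proj n w

/-- The grading operator `d` of a `ℤ`-graded space. -/
def ZGrading.d (G : ZGrading W) (v : W) : W := ∑ᶠ n : ℤ, (n : ℂ) • G.proj n v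

/-- The operator `z^d` on a `ℤ`-graded space. -/
def ZGrading.zd (G : ZGrading W) (z : ℂ) (v : W) : W := ∑ᶠ n : ℤ, (z ^ n) • G.proj n v

/-- The algebraic completion `∏ₙ W_[n]`, realized as the submodule of functions
`ℂ → W` recording a homogeneous component in each weight. -/
def CGrading.compSub (G : CGrading W) : Submodule ℂ (ℂ → W) where
  carrier := {f | ∀ n, G.proj n (f n) = f n}
  add_mem' := by
    intro a b ha hb n
    simp only [Pi.add_apply, map_add, ha n, hb n]
  zero_mem' := by
    intro n
    simp
  smul_mem' := by
    intro c f hf n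
    simp only [Pi.smul_apply, map_smul, hf n]

/-- The algebraic completion of a graded space. -/
abbrev CGrading.Comp (G : CGrading W) : Type _ := ↥G.compSub

/-- The pairing between the graded dual and the algebraic completion. -/
def CGrading.pair (G : CGrading W) (φ : W →ₗ[ℂ] ℂ) (f : G.Comp) : ℂ :=
  ∑ᶠ n : ℂ, φ (f.1 n)

/-- The embedding of `W` into its algebraic completion. -/
def CGrading.emb (G : CGrading W) (w : W) : G.Comp :=
  ⟨fun n => G.proj n w, by
    intro n
    have h := congrArg (fun T : W →ₗ[ℂ] W => T w) (G.proj_comp n n)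
    simpa using h⟩

/-- The componentwise extension of an operator on `W` to the algebraic completion. -/
def CGrading.ext (G : CGrading W) (L : W → W) (f : G.Comp) : G.Comp :=
  ⟨fun m => ∑ᶠ n : ℂ, G.proj m (L (f.1 n)), by
    intro m
    show G.proj m (∑ᶠ n : ℂ, G.proj m (L (f.1 n))) = ∑ᶠ n : ℂ, G.proj m (L (f.1 n))
    by_cases h : (Function.support fun n => G.proj m (L (f.1 n))).Finite
    · have h1 := AddMonoidHom.map_finsum (G.proj m).toAddMonoidHom h
      simp only [LinearMap.toAddMonoidHom_coe] at h1
      rw [h1]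
      refine finsum_congr fun n => ?_
      have h2 := congrArg (fun T : W →ₗ[ℂ] W => T (L (f.1 n))) (G.proj_comp m m)
      simpa using h2
    · rw [finsum_of_infinite_support h]
      simp⟩

/-- The operator `z^d` on the algebraic completion, acting on the component of
weight `n` by `z ^ n` (complex power). -/
def CGrading.zd (G : CGrading W) (z : ℂ) (f : G.Comp) : G.Comp :=
  ⟨fun n => (z ^ n) • f.1 n, by
    intro n
    rw [map_smul, f.2 n]⟩

end Graded


section VOA

/-- A meromorphic open-string vertex algebra (MOSVA): a lower-bounded `ℤ`-graded
space with a vertex operator map (recorded through its coefficients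
`Y u v k = (Y_V)_k(u)v`, the coefficient of `x^{-k-1}` in `Y_V(u,x)v`) and a
vacuum, satisfying the grading, vacuum, `D`-derivative/commutator, rationality and
associativity axioms. -/
structure MOSVA (V : Type*) [AddCommGroup V] [Module ℂ V] where
  gr : ZGrading V
  Y : V →ₗ[ℂ] V →ₗ[ℂ] (ℤ → V)
  vac : V
  /-- lower truncation of vertex operators -/
  trunc : ∀ u v : V, ∃ N : ℤ, ∀ k : ℤ, N ≤ k → Y u v k = 0
  /-- identity property `Y(𝟏,x) = 1` -/
  identity : ∀ (v : V) (k : ℤ), Y vac v k = if k = -1 then v else 0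
  /-- creation property: `Y(u,x)𝟏 ∈ V[[x]]` and `lim_{x→0} Y(u,x)𝟏 = u` -/
  creation : ∀ (u : V) (k : ℤ), 0 ≤ k → Y u vac k = 0
  creation_lim : ∀ u : V, Y u vac (-1) = u
  /-- the `d`-commutator formula, written in terms of coefficients -/
  d_comm : ∀ (u v : V) (k : ℤ),
    gr.d (Y u v k) = Y (gr.d u) v k + (-(k : ℂ) - 1) • Y u v k + Y u (gr.d v) k
  /-- the `D`-derivative property (`D_V u = (Y_V)_{-2}(u)𝟏`) -/
  D_deriv : ∀ (u v : V) (k : ℤ),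
    Y (Y u vac (-2)) v k = (-(k : ℂ)) • Y u v (k - 1)
  /-- the `D`-commutator formula -/
  D_comm : ∀ (u v : V) (k : ℤ),
    Y (Y u v k) vac (-2) - Y u (Y v vac (-2)) k = (-(k : ℂ)) • Y u v (k - 1)
  /-- rationality of products: matrix coefficients of products of vertex operators
  converge absolutely in the ordered region to rational functions with the only
  possible poles at `z i = 0` and `z i = z j` -/
  rationality : ∀ (n : ℕ) (u : Fin n → V) (v : V) (φ : V →ₗ[ℂ] ℂ),
    InGradedDual gr.proj φ → ∃ R : RatFn (Fin n), ∀ z : Fin n → ℂ, OrderedPos z →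
      AbsConvTo (fun k : Fin n → ℤ =>
          φ (compApply n (fun i x => Y (u i) x (k i)) v) * ∏ i, z i ^ (-(k i) - 1))
        (R.eval z)
  /-- rationality of iterates and associativity: products and iterates converge to a
  common rational function -/
  associativity : ∀ (u₁ u₂ v : V) (φ : V →ₗ[ℂ] ℂ), InGradedDual gr.proj φ →
    ∃ R : RatFn (Fin 2),
      (∀ z₁ z₂ : ℂ, ‖z₂‖ < ‖z₁‖ → 0 < ‖z₂‖ →
        AbsConvTo (fun k : ℤ × ℤ =>
            φ (Y u₁ (Y u₂ v k.2) k.1) * z₁ ^ (-k.1 - 1) * z₂ ^ (-k.2 - 1))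
          (R.eval ![z₁, z₂])) ∧
      (∀ z₁ z₂ : ℂ, ‖z₁ - z₂‖ < ‖z₂‖ → 0 < ‖z₁ - z₂‖ →
        AbsConvTo (fun k : ℤ × ℤ =>
            φ (Y (Y u₁ u₂ k.1) v k.2) * (z₁ - z₂) ^ (-k.1 - 1) * z₂ ^ (-k.2 - 1))
          (R.eval ![z₁, z₂]))

variable {V : Type*} [AddCommGroup V] [Module ℂ V]

/-- The operator `D_V`. -/
def MOSVA.D (A : MOSVA V) (v : V) : V := A.Y v A.vac (-2)

/-- The pole-order condition for a MOSVA. -/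
def MOSVA.PoleOrder (A : MOSVA V) : Prop :=
  ∀ u₁ v : V, ∃ C : ℕ, ∀ φ : V →ₗ[ℂ] ℂ, InGradedDual A.gr.proj φ → ∀ u₂ : V,
    ∃ R : RatFn (Fin 2), R.a 0 ≤ C ∧
      ∀ z₁ z₂ : ℂ, ‖z₂‖ < ‖z₁‖ → 0 < ‖z₂‖ →
        AbsConvTo (fun k : ℤ × ℤ =>
            φ (A.Y u₁ (A.Y u₂ v k.2) k.1) * z₁ ^ (-k.1 - 1) * z₂ ^ (-k.2 - 1))
          (R.eval ![z₁, z₂])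

/-- A bimodule for a MOSVA: a `ℂ`-graded space with left and right vertex operator
maps (recorded through their coefficients), satisfying the left module, right module
and compatibility axioms. -/
structure Bimod (A : MOSVA V) (W : Type*) [AddCommGroup W] [Module ℂ W] where
  gr : CGrading W
  YL : V →ₗ[ℂ] W →ₗ[ℂ] (ℤ → W)
  YR : W →ₗ[ℂ] V →ₗ[ℂ] (ℤ → W)
  DW : W →ₗ[ℂ] W
  /-- `D_W` has weight one -/
  DW_wt : ∀ n : ℂ, DW ∘ₗ gr.proj n = gr.proj (n + 1) ∘ₗ DW ∘ₗ gr.proj n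
  truncL : ∀ (u : V) (w : W), ∃ N : ℤ, ∀ k : ℤ, N ≤ k → YL u w k = 0
  truncR : ∀ (w : W) (u : V), ∃ N : ℤ, ∀ k : ℤ, N ≤ k → YR w u k = 0
  identityL : ∀ (w : W) (k : ℤ), YL A.vac w k = if k = -1 then w else 0
  creationR : ∀ (w : W) (k : ℤ), 0 ≤ k → YR w A.vac k = 0
  creationR_lim : ∀ w : W, YR w A.vac (-1) = w
  d_commL : ∀ (u : V) (w : W) (k : ℤ),
    gr.d (YL u w k) = YL (A.gr.d u) w k + (-(k : ℂ) - 1) • YL u w k + YL u (gr.d w) k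
  d_commR : ∀ (w : W) (u : V) (k : ℤ),
    gr.d (YR w u k) = YR (gr.d w) u k + (-(k : ℂ) - 1) • YR w u k + YR w (A.gr.d u) k
  D_derivL : ∀ (u : V) (w : W) (k : ℤ),
    YL (A.D u) w k = (-(k : ℂ)) • YL u w (k - 1)
  D_commL : ∀ (u : V) (w : W) (k : ℤ),
    DW (YL u w k) - YL u (DW w) k = (-(k : ℂ)) • YL u w (k - 1)
  D_derivR : ∀ (w : W) (u : V) (k : ℤ),
    YR (DW w) u k = (-(k : ℂ)) • YR w u (k - 1)
  D_commR : ∀ (w : W) (u : V) (k : ℤ),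
    DW (YR w u k) - YR w (A.D u) k = (-(k : ℂ)) • YR w u (k - 1)
  /-- rationality for products of left vertex operators -/
  rationalityL : ∀ (n : ℕ) (u : Fin n → V) (w : W) (φ : W →ₗ[ℂ] ℂ),
    InGradedDual gr.proj φ → ∃ R : RatFn (Fin n), ∀ z : Fin n → ℂ, OrderedPos z →
      AbsConvTo (fun k : Fin n → ℤ =>
          φ (compApply n (fun i x => YL (u i) x (k i)) w) * ∏ i, z i ^ (-(k i) - 1))
        (R.eval z)
  /-- rationality of iterates and associativity for the left vertex operator map -/
  associativityL : ∀ (u₁ u₂ : V) (w : W) (φ : W →ₗ[ℂ] ℂ), InGradedDual gr.proj φ →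
    ∃ R : RatFn (Fin 2),
      (∀ z₁ z₂ : ℂ, ‖z₂‖ < ‖z₁‖ → 0 < ‖z₂‖ →
        AbsConvTo (fun k : ℤ × ℤ =>
            φ (YL u₁ (YL u₂ w k.2) k.1) * z₁ ^ (-k.1 - 1) * z₂ ^ (-k.2 - 1))
          (R.eval ![z₁, z₂])) ∧
      (∀ z₁ z₂ : ℂ, ‖z₁ - z₂‖ < ‖z₂‖ → 0 < ‖z₁ - z₂‖ →
        AbsConvTo (fun k : ℤ × ℤ =>
            φ (YL (A.Y u₁ u₂ k.1) w k.2) * (z₁ - z₂) ^ (-k.1 - 1) * z₂ ^ (-k.2 - 1))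
          (R.eval ![z₁, z₂]))
  /-- rationality for products `Y_W^R(w,z₁)Y_V(u₁,z₂)⋯Y_V(u_{n-1},z_n)u_n` -/
  rationalityR : ∀ (n : ℕ) (w : W) (v : Fin (n+1) → V) (φ : W →ₗ[ℂ] ℂ),
    InGradedDual gr.proj φ → ∃ R : RatFn (Fin (n+1)),
      ∀ z : Fin (n+1) → ℂ, OrderedPos z →
        AbsConvTo (fun k : Fin (n+1) → ℤ =>
            φ (YR w (compApply n (fun i x => A.Y (v i.castSucc) x (k i.succ))
                (v (Fin.last n))) (k 0)) * ∏ i, z i ^ (-(k i) - 1))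
          (R.eval z)
  /-- rationality of iterates and associativity for the right vertex operator map -/
  associativityR : ∀ (w : W) (u₁ u₂ : V) (φ : W →ₗ[ℂ] ℂ), InGradedDual gr.proj φ →
    ∃ R : RatFn (Fin 2),
      (∀ z₁ z₂ : ℂ, ‖z₂‖ < ‖z₁‖ → 0 < ‖z₂‖ →
        AbsConvTo (fun k : ℤ × ℤ =>
            φ (YR w (A.Y u₁ u₂ k.2) k.1) * z₁ ^ (-k.1 - 1) * z₂ ^ (-k.2 - 1))
          (R.eval ![z₁, z₂])) ∧
      (∀ z₁ z₂ : ℂ, ‖z₁ - z₂‖ < ‖z₂‖ → 0 < ‖z₁ - z₂‖ →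
        AbsConvTo (fun k : ℤ × ℤ =>
            φ (YR (YR w u₁ k.1) u₂ k.2) * (z₁ - z₂) ^ (-k.1 - 1) * z₂ ^ (-k.2 - 1))
          (R.eval ![z₁, z₂]))
  /-- compatibility: rationality of mixed products
  `Y_W^L(u₁,z₁)⋯Y_W^L(u_p,z_p)Y_W^R(w,z₀)Y_V(v₁,⋅)⋯Y_V(v_{q},⋅)v_{q+1}` -/
  compatRat : ∀ (p q : ℕ) (u : Fin p → V) (w : W) (v : Fin (q+1) → V)
      (φ : W →ₗ[ℂ] ℂ), InGradedDual gr.proj φ →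
    ∃ R : RatFn (Fin p ⊕ Fin (q+1)),
      ∀ (zL : Fin p → ℂ) (z0 : ℂ) (zR : Fin q → ℂ),
        Ordered zL → (∀ i, ‖z0‖ < ‖zL i‖) → (∀ j, ‖zR j‖ < ‖z0‖) → Ordered zR →
        0 < ‖z0‖ → (∀ j, 0 < ‖zR j‖) →
        AbsConvTo (fun K : (Fin p → ℤ) × ℤ × (Fin q → ℤ) =>
            φ (compApply p (fun i x => YL (u i) x (K.1 i))
                (YR w (compApply q (fun j x => A.Y (v j.castSucc) x (K.2.2 j))
                  (v (Fin.last q))) K.2.1))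
              * (∏ i, zL i ^ (-(K.1 i) - 1)) * z0 ^ (-K.2.1 - 1)
              * ∏ j, zR j ^ (-(K.2.2 j) - 1))
          (R.eval (Sum.elim zL (Fin.cons z0 zR)))
  /-- compatibility: associativity for the left and right vertex operator maps -/
  compatAssoc : ∀ (u v : V) (w : W) (φ : W →ₗ[ℂ] ℂ), InGradedDual gr.proj φ →
    ∃ R : RatFn (Fin 2),
      (∀ z₁ z₂ : ℂ, ‖z₂‖ < ‖z₁‖ → 0 < ‖z₂‖ →
        AbsConvTo (fun k : ℤ × ℤ =>
            φ (YL u (YR w v k.2) k.1) * z₁ ^ (-k.1 - 1) * z₂ ^ (-k.2 - 1))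
          (R.eval ![z₁, z₂])) ∧
      (∀ z₁ z₂ : ℂ, ‖z₁ - z₂‖ < ‖z₂‖ → 0 < ‖z₁ - z₂‖ →
        AbsConvTo (fun k : ℤ × ℤ =>
            φ (YR (YL u w k.1) v k.2) * (z₁ - z₂) ^ (-k.1 - 1) * z₂ ^ (-k.2 - 1))
          (R.eval ![z₁, z₂]))

variable {W : Type*} [AddCommGroup W] [Module ℂ W] {A : MOSVA V}

/-- The opposite right vertex operator map
`Y_W^{s(R)}(v,x)w = e^{xD_W}Y_W^R(w,-x)v`, through its coefficients. -/
def Bimod.YsR (B : Bimod A W) (v : V) (w : W) (k : ℤ) : W :=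
  ∑ᶠ m : ℕ, (((-1 : ℂ) ^ (k + (m : ℤ) + 1)) * ((m.factorial : ℂ))⁻¹) •
    ((B.DW ^ m) (B.YR w v (k + (m : ℤ))))

/-- The pole-order condition for a bimodule over a MOSVA. -/
def Bimod.PoleOrder (B : Bimod A W) : Prop :=
  (∀ (u₁ : V) (w : W), ∃ C : ℕ, ∀ φ : W →ₗ[ℂ] ℂ, InGradedDual B.gr.proj φ → ∀ u₂ : V,
    ∃ R : RatFn (Fin 2), R.a 0 ≤ C ∧
      ∀ z₁ z₂ : ℂ, ‖z₂‖ < ‖z₁‖ → 0 < ‖z₂‖ →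
        AbsConvTo (fun k : ℤ × ℤ =>
            φ (B.YL u₁ (B.YL u₂ w k.2) k.1) * z₁ ^ (-k.1 - 1) * z₂ ^ (-k.2 - 1))
          (R.eval ![z₁, z₂])) ∧
  (∀ (u₂ : V) (w : W), ∃ C : ℕ, ∀ φ : W →ₗ[ℂ] ℂ, InGradedDual B.gr.proj φ → ∀ u₁ : V,
    ∃ R : RatFn (Fin 2), R.a 0 ≤ C ∧
      ∀ z₁ z₂ : ℂ, ‖z₂‖ < ‖z₁‖ → 0 < ‖z₂‖ →
        AbsConvTo (fun k : ℤ × ℤ =>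
            φ (B.YR w (A.Y u₁ u₂ k.2) k.1) * z₁ ^ (-k.1 - 1) * z₂ ^ (-k.2 - 1))
          (R.eval ![z₁, z₂])) ∧
  (∀ (u₁ u₂ : V), ∃ C : ℕ, ∀ φ : W →ₗ[ℂ] ℂ, InGradedDual B.gr.proj φ → ∀ w : W,
    ∃ R : RatFn (Fin 2), R.a 0 ≤ C ∧
      ∀ z₁ z₂ : ℂ, ‖z₂‖ < ‖z₁‖ → 0 < ‖z₂‖ →
        AbsConvTo (fun k : ℤ × ℤ =>
            φ (B.YL u₁ (B.YR w u₂ k.2) k.1) * z₁ ^ (-k.1 - 1) * z₂ ^ (-k.2 - 1))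
          (R.eval ![z₁, z₂]))

end VOA


section Cochains

variable {V : Type*} [AddCommGroup V] [Module ℂ V]
variable {W : Type*} [AddCommGroup W] [Module ℂ W] {A : MOSVA V}

/-- A `W̄`-valued rational function in the variables `z i`, `i : ι`, with the only
possible poles at `z i = z j`: a map from configuration space to the algebraic
completion whose pairings with graded-dual functionals are such rational functions,
with pole orders uniform in the functional, as witnessed by a formal power series
with coefficients in `W` (condition (ii)). -/
def CGrading.WTilde (G : CGrading W) {ι : Type*} [Fintype ι] [DecidableEq ι]
    (f : (ι → ℂ) → G.Comp) : Prop :=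
  (∀ φ : W →ₗ[ℂ] ℂ, InGradedDual G.proj φ →
      ∃ R : DiagRatFn ι, ∀ z : ι → ℂ, Conf z → G.pair φ (f z) = R.eval z) ∧
  ∃ (p : ι → ι → ℤ) (b : (ι → ℕ) → W),
    ∀ φ : W →ₗ[ℂ] ℂ, InGradedDual G.proj φ →
      (Function.support fun k => φ (b k)).Finite ∧
      ∀ z : ι → ℂ, Conf z →
        (∏ q ∈ Finset.univ.offDiag, (z q.1 - z q.2) ^ (p q.1 q.2)) * G.pair φ (f z)
          = ∑ᶠ k : ι → ℕ, φ (b k) * ∏ i, z i ^ (k i)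

/-- The pattern of left/right vertex operators: the `i`-th operator is
`Y_W^L(u i, z i)` if `isL i`, and `Y_W^{s(R)}(u i, z i)` otherwise; `k` records the
coefficient extracted from each operator. -/
def patOps (B : Bimod A W) {n : ℕ} (isL : Fin n → Bool) (u : Fin n → V)
    (k : Fin n → ℤ) : Fin n → (W → W) :=
  fun i => if isL i then fun x => B.YL (u i) x (k i) else fun x => B.YsR (u i) x (k i)

/-- The pattern with `l` left operators followed by `n - l` opposite right operators. -/
def prefixPat (n l : ℕ) : Fin n → Bool := fun i => decide ((i : ℕ) < l)

/-- A vector `w` such that `Y_W^L(u,x)w ∈ W[[x]]` and `Y_W^{s(R)}(u,x)w ∈ W[[x]]`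
for every `u ∈ V`. -/
def Bimod.RegVec (B : Bimod A W) (w : W) : Prop :=
  ∀ (u : V) (k : ℤ), 0 ≤ k → B.YL u w k = 0 ∧ B.YsR u w k = 0

/-- `f` represents the `W̄`-valued rational function
`E(Y^{L/sR}(u 0, z 0)⋯Y^{L/sR}(u (n-1), z (n-1)) w)` (with the operators prescribed
by the pattern `isL`): `f` is a `W̄`-valued rational function with only diagonal
poles whose pairings are the sums of the corresponding series of matrix coefficients
on the region `|z 0| > ⋯ > |z (n-1)| > 0`. -/
def RepEPat (B : Bimod A W) {n : ℕ} (isL : Fin n → Bool) (u : Fin n → V) (w : W)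
    (f : (Fin n → ℂ) → B.gr.Comp) : Prop :=
  B.gr.WTilde f ∧
  ∀ φ : W →ₗ[ℂ] ℂ, InGradedDual B.gr.proj φ → ∀ z : Fin n → ℂ, OrderedPos z →
    AbsConvTo (fun k : Fin n → ℤ =>
        φ (compApply n (patOps B isL u k) w) * ∏ i, z i ^ (-(k i) - 1))
      (B.gr.pair φ (f z))

/-- `f` represents the `W̄`-valued rational function given by a product of groups of
vertex operators, with group `i` of size `α i` and left/right pattern `isL`;
the variables are indexed by the sigma type `(i : Fin N) × Fin (α i)`. -/
def RepESig (B : Bimod A W) {N : ℕ} (α : Fin N → ℕ)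
    (isL : (i : Fin N) → Fin (α i) → Bool)
    (u : (i : Fin N) → Fin (α i) → V) (w : W)
    (f : (((i : Fin N) × Fin (α i)) → ℂ) → B.gr.Comp) : Prop :=
  B.gr.WTilde f ∧
  ∀ φ : W →ₗ[ℂ] ℂ, InGradedDual B.gr.proj φ →
    ∀ Z : (i : Fin N) → Fin (α i) → ℂ,
      (∀ (i : Fin N) (s t : Fin (α i)), s < t → ‖Z i t‖ < ‖Z i s‖) →
      (∀ (i j : Fin N), i < j → ∀ (s : Fin (α i)) (t : Fin (α j)), ‖Z j t‖ < ‖Z i s‖) →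
      (∀ (i : Fin N) (s : Fin (α i)), 0 < ‖Z i s‖) →
      AbsConvTo (fun K : (i : Fin N) → Fin (α i) → ℤ =>
          φ (compApply N (fun i x => compApply (α i) (fun s y =>
              if isL i s then B.YL (u i s) y (K i s) else B.YsR (u i s) y (K i s)) x) w)
            * ∏ i, ∏ s, Z i s ^ (-(K i s) - 1))
        (B.gr.pair φ (f (fun q => Z q.1 q.2)))

/-- Multilinearity of a map on `n`-tuples of vectors. -/
def IsMultilinear {M : Type*} [AddCommMonoid M] [Module ℂ M] {n : ℕ}
    (Φ : (Fin n → V) → M) : Prop :=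
  (∀ (v : Fin n → V) (i : Fin n) (x y : V),
      Φ (Function.update v i (x + y)) = Φ (Function.update v i x) + Φ (Function.update v i y)) ∧
  ∀ (v : Fin n → V) (i : Fin n) (c : ℂ) (x : V),
      Φ (Function.update v i (c • x)) = c • Φ (Function.update v i x)

/-- The `D`-derivative property of a map `Φ : V^{⊗n} → W̃_{z₁,…,zₙ}`. -/
def DDerivProp (A : MOSVA V) (B : Bimod A W) {n : ℕ}
    (Φ : (Fin n → V) → (Fin n → ℂ) → B.gr.Comp) : Prop :=
  (∀ (v : Fin n → V) (i : Fin n) (φ : W →ₗ[ℂ] ℂ), InGradedDual B.gr.proj φ →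
    ∀ z : Fin n → ℂ, Conf z →
      HasDerivAt (fun t : ℂ => B.gr.pair φ (Φ v (Function.update z i t)))
        (B.gr.pair φ (Φ (Function.update v i (A.D (v i))) z)) (z i)) ∧
  (∀ (v : Fin n → V) (φ : W →ₗ[ℂ] ℂ), InGradedDual B.gr.proj φ →
    ∀ z : Fin n → ℂ, Conf z →
      B.gr.pair φ (B.gr.ext (⇑B.DW) (Φ v z)) =
        ∑ i, B.gr.pair φ (Φ (Function.update v i (A.D (v i))) z))

/-- The `d`-conjugation property of a map `Φ : V^{⊗n} → W̃_{z₁,…,zₙ}`. -/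
def DConjProp (A : MOSVA V) (B : Bimod A W) {n : ℕ}
    (Φ : (Fin n → V) → (Fin n → ℂ) → B.gr.Comp) : Prop :=
  ∀ (v : Fin n → V) (φ : W →ₗ[ℂ] ℂ), InGradedDual B.gr.proj φ →
    ∀ (z : Fin n → ℂ) (c : ℂ), c ≠ 0 → Conf z → Conf (fun i => c * z i) →
      B.gr.pair φ (B.gr.zd c (Φ v z)) =
        B.gr.pair φ (Φ (fun i => A.gr.zd c (v i)) (fun i => c * z i))

/-- Composability of `Φ : V^{⊗n} → W̃` with `m` vertex operators. -/
def ComposableWith (A : MOSVA V) (B : Bimod A W) (n m : ℕ)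
    (Φ : (Fin n → V) → (Fin n → ℂ) → B.gr.Comp) : Prop :=
  ∃ Cb : V → V → ℕ,
  ∀ (α : Fin (n+1) → ℕ), (∑ i, α i) = m + n →
  ∀ l₀ : ℕ, l₀ ≤ α 0 →
  ∀ u : (i : Fin (n+1)) → Fin (α i) → V,
  ∀ φ : W →ₗ[ℂ] ℂ, InGradedDual B.gr.proj φ →
  ∃ R : DiagRatFn ((i : Fin (n+1)) × Fin (α i)),
    (∀ q q' : (i : Fin (n+1)) × Fin (α i), R.b q q' ≤ Cb (u q.1 q.2) (u q'.1 q'.2)) ∧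
    ∀ (z : (i : Fin (n+1)) → Fin (α i) → ℂ) (ζ : Fin n → ℂ),
      (∀ s t : Fin (α 0), s < t → ‖z 0 t‖ < ‖z 0 s‖) →
      (∀ (j : Fin (α 0)) (i : Fin n) (t : Fin (α i.succ)),
          ‖ζ i‖ + ‖z i.succ t - ζ i‖ < ‖z 0 j‖) →
      (∀ (i : Fin n) (s t : Fin (α i.succ)), s < t →
          ‖z i.succ t - ζ i‖ < ‖z i.succ s - ζ i‖) →
      (∀ (i j : Fin n), i < j → ∀ (s : Fin (α i.succ)) (t : Fin (α j.succ)),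
          ‖(z i.succ s - ζ i) - (z j.succ t - ζ j)‖ < ‖ζ i - ζ j‖) →
      AbsConvTo (fun K : (i : Fin (n+1)) → Fin (α i) → ℤ =>
          B.gr.pair φ
            (compApply (α 0) (fun j => B.gr.ext (fun x =>
                if (j : ℕ) < l₀ then B.YL (u 0 j) x (K 0 j) else B.YsR (u 0 j) x (K 0 j)))
              (Φ (fun i => compApply (α i.succ)
                    (fun s x => A.Y (u i.succ s) x (K i.succ s)) A.vac) ζ))
            * (∏ j, z 0 j ^ (-(K 0 j) - 1))
            * ∏ i : Fin n, ∏ s, (z i.succ s - ζ i) ^ (-(K i.succ s) - 1))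
        (R.eval (fun q => z q.1 q.2))

/-- The set `Ĉ^n_m(V,W)`: maps `V^{⊗n} → W̃_{z₁,…,zₙ}` that are linear, satisfy the
`D`-derivative and `d`-conjugation properties and are composable with `m` vertex
operators. -/
def IsCochain (A : MOSVA V) (B : Bimod A W) (n m : ℕ)
    (Φ : (Fin n → V) → (Fin n → ℂ) → B.gr.Comp) : Prop :=
  IsMultilinear Φ ∧ (∀ v, B.gr.WTilde (Φ v)) ∧ DDerivProp A B Φ ∧ DConjProp A B Φ ∧
    ComposableWith A B n m Φ

/-- `Ψ` represents `E_W^{(1,0)} ∘₂ Φ`, i.e. the map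
`v ↦ E(Y_W^L(v 0, z 0) Φ(v 1 ⊗ ⋯ ⊗ v n)(z 1,…,z n))`. -/
def RepLeft (A : MOSVA V) (B : Bimod A W) {n : ℕ}
    (Φ : (Fin n → V) → (Fin n → ℂ) → B.gr.Comp)
    (Ψ : (Fin (n+1) → V) → (Fin (n+1) → ℂ) → B.gr.Comp) : Prop :=
  (∀ v, B.gr.WTilde (Ψ v)) ∧
  ∀ (v : Fin (n+1) → V) (φ : W →ₗ[ℂ] ℂ), InGradedDual B.gr.proj φ →
    ∀ (z₀ : ℂ) (zt : Fin n → ℂ), Conf (Fin.cons z₀ zt) →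
      (∀ i, ‖zt i‖ < ‖z₀‖) → (∀ i, 0 < ‖zt i‖) →
      AbsConvTo (fun k : ℤ =>
          B.gr.pair φ (B.gr.ext (fun x => B.YL (v 0) x k) (Φ (Fin.tail v) zt))
            * z₀ ^ (-k - 1))
        (B.gr.pair φ (Ψ v (Fin.cons z₀ zt)))

/-- `Ψ` represents `E_W^{(0,1)} ∘₂ Φ`, i.e. the map
`v ↦ E(Y_W^{s(R)}(v (n+1), z (n+1)) Φ(v 1 ⊗ ⋯ ⊗ v n)(z 1,…,z n))`. -/
def RepRight (A : MOSVA V) (B : Bimod A W) {n : ℕ}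
    (Φ : (Fin n → V) → (Fin n → ℂ) → B.gr.Comp)
    (Ψ : (Fin (n+1) → V) → (Fin (n+1) → ℂ) → B.gr.Comp) : Prop :=
  (∀ v, B.gr.WTilde (Ψ v)) ∧
  ∀ (v : Fin (n+1) → V) (φ : W →ₗ[ℂ] ℂ), InGradedDual B.gr.proj φ →
    ∀ (zl : ℂ) (zi : Fin n → ℂ), Conf (Fin.snoc zi zl) →
      (∀ i, ‖zi i‖ < ‖zl‖) → (∀ i, 0 < ‖zi i‖) →
      AbsConvTo (fun k : ℤ =>
          B.gr.pair φ (B.gr.ext (fun x => B.YsR (v (Fin.last n)) x k) (Φ (Fin.init v) zi))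
            * zl ^ (-k - 1))
        (B.gr.pair φ (Ψ v (Fin.snoc zi zl)))

/-- Replace the two adjacent entries `i, i+1` of an `(n+1)`-tuple by a single entry. -/
def mergeAt {M : Type*} {n : ℕ} (i : Fin n) (v : Fin (n+1) → M) (a : M) : Fin n → M :=
  fun j => if j < i then v j.castSucc else if j = i then a else v j.succ

/-- `Ψ` represents `Φ ∘ᵢ E_V^{(2)}`, i.e. the map
`v ↦ E(Φ(v 1 ⊗ ⋯ ⊗ Y_V(v i, z i − ζ)Y_V(v (i+1), z (i+1) − ζ)𝟏 ⊗ ⋯ ⊗ v (n+1))(…,ζ,…))`. -/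
def RepCirc (A : MOSVA V) (B : Bimod A W) {n : ℕ} (i : Fin n)
    (Φ : (Fin n → V) → (Fin n → ℂ) → B.gr.Comp)
    (Ψ : (Fin (n+1) → V) → (Fin (n+1) → ℂ) → B.gr.Comp) : Prop :=
  (∀ v, B.gr.WTilde (Ψ v)) ∧
  ∀ (v : Fin (n+1) → V) (φ : W →ₗ[ℂ] ℂ), InGradedDual B.gr.proj φ →
    ∀ (z : Fin (n+1) → ℂ) (ζ : ℂ), Conf z → Conf (mergeAt i z ζ) →
      ‖z i.succ - ζ‖ < ‖z i.castSucc - ζ‖ → 0 < ‖z i.succ - ζ‖ →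
      (∀ j : Fin (n+1), j ≠ i.castSucc → j ≠ i.succ →
        ‖z i.castSucc - ζ‖ < ‖z j - z i.castSucc‖ ∧ ‖z i.succ - ζ‖ < ‖z j - z i.succ‖) →
      AbsConvTo (fun k : ℤ × ℤ =>
          B.gr.pair φ
            (Φ (mergeAt i v (A.Y (v i.castSucc) (A.Y (v i.succ) A.vac k.2) k.1))
              (mergeAt i z ζ))
            * (z i.castSucc - ζ) ^ (-k.1 - 1) * (z i.succ - ζ) ^ (-k.2 - 1))
        (B.gr.pair φ (Ψ v z))

/-- `Ψ` represents the coboundary `δ̂Φ = E_W^{(1,0)}∘₂Φ + Σᵢ (−1)^i Φ∘ᵢE_V^{(2)}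
+ (−1)^{n+1} E_W^{(0,1)}∘₂Φ` of the `n`-cochain `Φ`. -/
def IsDelta (A : MOSVA V) (B : Bimod A W) {n : ℕ}
    (Φ : (Fin n → V) → (Fin n → ℂ) → B.gr.Comp)
    (Ψ : (Fin (n+1) → V) → (Fin (n+1) → ℂ) → B.gr.Comp) : Prop :=
  ∃ (gL gR : (Fin (n+1) → V) → (Fin (n+1) → ℂ) → B.gr.Comp)
    (gC : Fin n → (Fin (n+1) → V) → (Fin (n+1) → ℂ) → B.gr.Comp),
    RepLeft A B Φ gL ∧ RepRight A B Φ gR ∧ (∀ i, RepCirc A B i Φ (gC i)) ∧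
    ∀ v z, Ψ v z = gL v z + (∑ i : Fin n, ((-1 : ℂ) ^ ((i : ℕ) + 1)) • gC i v z)
      + ((-1 : ℂ) ^ (n + 1)) • gR v z

end Cochains

section Iterates

open Filter Topology

theorem absConvTo_iff {ι : Type*} {f : ι → ℂ} {s : ℂ} : AbsConvTo f s ↔ HasSum f s :=
  ⟨And.right, fun h => ⟨h.summable.norm, h⟩⟩

theorem HasSum.of_eq {ι : Type*} {f g : ι → ℂ} {s : ℂ} (h : HasSum f s) (hfg : ∀ i, g i = f i) :
    HasSum g s :=
  (funext hfg : g = f) ▸ h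

theorem ite_eq_indicator {J : Type*} (f : J → ℂ) (p : J → Prop) [DecidablePred p] :
    (fun j => if p j then f j else 0) = {j | p j}.indicator f := by
  funext j
  simp [Set.indicator]

theorem summable_ite {J : Type*} {f : J → ℂ} (hf : Summable f) (p : J → Prop)
    [DecidablePred p] :
    Summable fun j => if p j then f j else 0 := by
  rw [ite_eq_indicator]
  exact hf.indicator {j | p j}

theorem hasSum_fiberwise {J K : Type*} [DecidableEq K] {f : J → ℂ} {S : ℂ} (hf : HasSum f S)
    (g : J → K) {v : K → ℂ} (hv : ∀ k, HasSum (fun j => if g j = k then f j else 0) (v k)) :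
    HasSum v S := by
  refine ((Equiv.sigmaFiberEquiv g).hasSum_iff.mpr hf).sigma fun k => ?_
  have h := hv k
  rw [ite_eq_indicator] at h
  exact hasSum_subtype_iff_indicator.mpr h

open Classical in
/-- The lowest-order coefficient of a generalized power series vanishing near `0⁺` is zero. -/
theorem hasSum_lowest_slice {J : Type*} (c : J → ℂ) (T : J → ℤ) (N : ℤ)
    (hN : ∀ j, c j ≠ 0 → N ≤ T j)
    (h : ∀ᶠ s : ℝ in 𝓝[>] 0, HasSum (fun j => c j * (s : ℂ) ^ T j) 0) :
    HasSum (fun j => if T j = N then c j else 0) 0 := by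
  have hpos : ∀ᶠ s : ℝ in 𝓝[>] 0, 0 < s := eventually_mem_nhdsWithin
  obtain ⟨s₀, hs₀, hp₀⟩ := (h.and hpos).exists
  have shift : ∀ s : ℝ, 0 < s → HasSum (fun j => c j * (s : ℂ) ^ T j) 0 →
      HasSum (fun j => c j * (s : ℂ) ^ (T j - N)) 0 := by
    intro s hs hsum
    have hc : (s : ℂ) ≠ 0 := by exact_mod_cast hs.ne'
    have := hsum.mul_right ((s : ℂ) ^ (-N))
    rw [zero_mul] at this
    refine HasSum.of_eq this fun j => ?_
    rw [mul_assoc, ← zpow_add₀ hc, sub_eq_add_neg]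
  have hbound := (shift s₀ hp₀ hs₀).summable.norm
  have hsm : ∀ᶠ s : ℝ in 𝓝[>] 0, s < s₀ :=
    mem_nhdsWithin_of_mem_nhds (Iio_mem_nhds hp₀)
  have key := tendsto_tsum_of_dominated_convergence (𝓕 := 𝓝[>] (0 : ℝ))
    (f := fun s j => c j * (s : ℂ) ^ (T j - N)) (g := fun j => if T j = N then c j else 0)
    hbound (by
      intro j
      by_cases hj : c j = 0
      · simp [hj]
      by_cases hT : T j = N
      · simp [hT]
      · have hlt : N < T j := lt_of_le_of_ne (hN j hj) (Ne.symm hT)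
        obtain ⟨d, hd⟩ := Int.eq_ofNat_of_zero_le (sub_nonneg.mpr hlt.le)
        have hd0 : d ≠ 0 := by rintro rfl; simp at hd; omega
        simp only [hT, if_false, hd, zpow_natCast]
        have : Tendsto (fun s : ℝ => c j * (s : ℂ) ^ d) (𝓝 0) (𝓝 (c j * ((0 : ℝ) : ℂ) ^ d)) :=
          (Continuous.tendsto (by fun_prop) 0)
        simpa [hd0] using this.mono_left nhdsWithin_le_nhds)
    (by
      filter_upwards [hpos, hsm] with s hs hss j
      by_cases hj : c j = 0
      · simp [hj]
      obtain ⟨d, hd⟩ := Int.eq_ofNat_of_zero_le (sub_nonneg.mpr (hN j hj))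
      simp only [hd, zpow_natCast, norm_mul, norm_pow, Complex.norm_real, Real.norm_eq_abs,
        abs_of_pos hs, abs_of_pos hp₀]
      gcongr)
  have hz : Tendsto (fun s : ℝ => ∑' j, c j * (s : ℂ) ^ (T j - N)) (𝓝[>] 0) (𝓝 0) := by
    refine tendsto_const_nhds.congr' ?_
    filter_upwards [h, hpos] with s hs hs0
    exact (shift s hs0 hs).tsum_eq.symm
  have h0 := tendsto_nhds_unique key hz
  have hsum : Summable fun j => if T j = N then c j else 0 := by
    refine Summable.of_norm_bounded hbound fun j => ?_
    split_ifs with hj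
    · simp [hj]
    · simpa using by positivity
  have h1 := hsum.hasSum
  rw [h0] at h1
  exact h1

open Classical in
/-- All coefficients of a generalized power series vanishing near `0⁺` are zero. -/
theorem hasSum_slice {J : Type*} (c : J → ℂ) (T : J → ℤ) (N : ℤ)
    (hN : ∀ j, c j ≠ 0 → N ≤ T j)
    (h : ∀ᶠ s : ℝ in 𝓝[>] 0, HasSum (fun j => c j * (s : ℂ) ^ T j) 0) (k : ℤ) :
    HasSum (fun j => if T j = k then c j else 0) 0 := by
  by_cases hk : k < N
  · refine HasSum.of_eq hasSum_zero fun j => ?_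
    by_cases hj : c j = 0
    · simp [hj]
    · have := hN j hj
      rw [if_neg (by omega)]
  obtain ⟨d, hd⟩ := Int.eq_ofNat_of_zero_le (sub_nonneg.mpr (not_lt.mp hk))
  clear hk
  induction d generalizing c N with
  | zero =>
    have hkN : k = N := by simpa [sub_eq_zero] using hd
    subst hkN
    exact hasSum_lowest_slice c T k hN h
  | succ d ih =>
    have h0 := hasSum_lowest_slice c T N hN h
    have := ih (fun j => if T j = N then 0 else c j) (N + 1) (by
        intro j hj
        by_cases hT : T j = N
        · simp [hT] at hj
        · simp only [hT, if_false] at hj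
          have := hN j hj
          omega) (by
        filter_upwards [h] with s hs
        have h1 := hs.sub (h0.mul_right ((s : ℂ) ^ N))
        rw [zero_mul, sub_zero] at h1
        refine HasSum.of_eq h1 fun j => ?_
        by_cases hT : T j = N <;> simp [hT]) (by push_cast at hd; omega)
    refine HasSum.of_eq this fun j => ?_
    have : k ≠ N := by push_cast at hd; omega
    by_cases hT : T j = k
    · simp [hT, this]
    · simp [hT]

/-- The sum of the entries with index at least `r`. -/
def tail {n : ℕ} (r : Fin n) : (Fin n → ℤ) →+ ℤ where
  toFun e := ∑ i, if r ≤ i then e i else 0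
  map_zero' := by simp
  map_add' e e' := by
    rw [← Finset.sum_add_distrib]
    exact Finset.sum_congr rfl fun i _ => by split_ifs <;> simp

theorem tail_apply {n : ℕ} (r : Fin n) (e : Fin n → ℤ) :
    tail r e = ∑ i, if r ≤ i then e i else 0 := rfl

theorem tail_single {n : ℕ} (r i : Fin n) (a : ℤ) :
    tail r (Pi.single i a) = if r ≤ i then a else 0 := by
  rw [tail_apply, Finset.sum_eq_single i]
  · simp
  · intro j _ hj
    simp [hj]
  · simp

open Classical in
/-- The coefficients of an iterated Laurent series vanishing at all small decreasing tuples of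
positive reals are zero. -/
theorem hasSum_multislice {J : Type*} (M : ℕ) (c : J → ℂ) (E : J → Fin M → ℤ) (N : ℤ)
    (hN : ∀ j, c j ≠ 0 → ∀ r, N ≤ tail r (E j)) (ε : ℝ) (hε : 0 < ε)
    (h : ∀ x : Fin M → ℝ, (∀ i, 0 < x i ∧ x i < ε) → StrictAnti x →
      HasSum (fun j => c j * ∏ i, (x i : ℂ) ^ E j i) 0) (n : Fin M → ℤ) :
    HasSum (fun j => if E j = n then c j else 0) 0 := by
  induction M generalizing c N with
  | zero =>
    have := h (fun _ => 1) (fun i => i.elim0) (fun i => i.elim0)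
    simpa [Subsingleton.elim _ n] using this
  | succ M ih =>
    have htail : ∀ (r : Fin M) (e : Fin (M + 1) → ℤ),
        tail r (Fin.init e) = tail r.castSucc e - e (Fin.last M) := by
      intro r e
      rw [tail_apply, tail_apply, Fin.sum_univ_castSucc]
      simp [Fin.le_last, Fin.init]
    have := ih (fun j => if E j (Fin.last M) = n (Fin.last M) then c j else 0)
      (fun j => Fin.init (E j)) (N - n (Fin.last M)) (by
        intro j hj r
        by_cases hl : E j (Fin.last M) = n (Fin.last M)
        · simp only [hl, if_true] at hj
          rw [htail, hl]
          have := hN j hj r.castSucc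
          omega
        · simp [hl] at hj) (by
        intro x hx hmono
        have hs := hasSum_slice (fun j => c j * ∏ i, (x i : ℂ) ^ Fin.init (E j) i)
          (fun j => E j (Fin.last M)) N (by
            intro j hj
            have hj' := hN j (left_ne_zero_of_mul hj) (Fin.last M)
            rw [tail_apply, Finset.sum_eq_single (Fin.last M)] at hj'
            · simpa using hj'
            · intro i _ hi
              rw [if_neg]
              exact fun hle => hi (Fin.last_le_iff.mp hle)
            · simp) (by
            have h1 : ∀ᶠ s : ℝ in 𝓝[>] 0, s < ε :=
              mem_nhdsWithin_of_mem_nhds (Iio_mem_nhds hε)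
            have h2 : ∀ᶠ s : ℝ in 𝓝[>] 0, ∀ i, s < x i := by
              rw [eventually_all]
              exact fun i => mem_nhdsWithin_of_mem_nhds (Iio_mem_nhds (hx i).1)
            have h3 : ∀ᶠ s : ℝ in 𝓝[>] 0, 0 < s := eventually_mem_nhdsWithin
            filter_upwards [h1, h2, h3] with s hs1 hs2 hs3
            have := h (Fin.snoc x s) (by
                intro i
                refine Fin.lastCases ?_ (fun i => ?_) i
                · simpa using ⟨hs3, hs1⟩
                · simpa using hx i) (by
                intro i j hij
                induction j using Fin.lastCases with
                | last =>
                  induction i using Fin.lastCases with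
                  | last => exact absurd hij (lt_irrefl _)
                  | cast i => simpa using hs2 i
                | cast j =>
                  induction i using Fin.lastCases with
                  | last => exact absurd hij (not_lt.mpr (Fin.le_last _))
                  | cast i => simpa using hmono (by simpa using hij))
            refine HasSum.of_eq this fun j => ?_
            rw [Fin.prod_univ_castSucc]
            simp [Fin.init, mul_assoc]) (n (Fin.last M))
        refine HasSum.of_eq hs fun j => ?_
        split_ifs <;> simp) (Fin.init n)
    refine HasSum.of_eq this fun j => ?_
    have hiff : E j = n ↔ E j (Fin.last M) = n (Fin.last M) ∧ Fin.init (E j) = Fin.init n := by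
      constructor
      · intro hj; simp [hj]
      · rintro ⟨h1, h2⟩
        rw [← Fin.snoc_init_self (E j), ← Fin.snoc_init_self n, h1, h2]
    by_cases h1 : E j (Fin.last M) = n (Fin.last M) <;>
      by_cases h2 : Fin.init (E j) = Fin.init n <;> simp [hiff, h1, h2]

theorem HasSum.sum_neg {J₁ J₂ : Type*} {f₁ : J₁ → ℂ} {f₂ : J₂ → ℂ} {S : ℂ}
    (h₁ : HasSum f₁ S) (h₂ : HasSum f₂ S) : HasSum (Sum.elim f₁ fun j => -f₂ j) 0 := by
  rw [← add_neg_cancel S]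
  exact HasSum.sum h₁ h₂.neg

theorem exists_hasSum_of_sum_neg {J₁ J₂ : Type*} {f₁ : J₁ → ℂ} {f₂ : J₂ → ℂ}
    (h : HasSum (Sum.elim f₁ fun j => -f₂ j) 0) : ∃ v, HasSum f₁ v ∧ HasSum f₂ v := by
  have s₁ : Summable f₁ := h.summable.comp_injective Sum.inl_injective
  have s₂ : Summable fun j => -f₂ j := h.summable.comp_injective Sum.inr_injective
  have s₂' : Summable f₂ := by simpa using s₂.neg
  have := h.unique (HasSum.sum (f := Sum.elim f₁ fun j => -f₂ j) s₁.hasSum s₂'.hasSum.neg)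
  refine ⟨_, s₁.hasSum, ?_⟩
  have h2 : ∑' j, f₁ j = ∑' j, f₂ j := by linear_combination -this
  rw [h2]
  exact s₂'.hasSum

open Classical in
theorem exists_hasSum_slice {J₁ J₂ : Type*} (c₁ : J₁ → ℂ) (T₁ : J₁ → ℤ) (c₂ : J₂ → ℂ)
    (T₂ : J₂ → ℤ) (h₁ : ∃ N, ∀ j, c₁ j ≠ 0 → N ≤ T₁ j) (h₂ : ∃ N, ∀ j, c₂ j ≠ 0 → N ≤ T₂ j)
    (h : ∀ᶠ s : ℝ in 𝓝[>] 0, ∃ S, HasSum (fun j => c₁ j * (s : ℂ) ^ T₁ j) S ∧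
      HasSum (fun j => c₂ j * (s : ℂ) ^ T₂ j) S) (k : ℤ) :
    ∃ v, HasSum (fun j => if T₁ j = k then c₁ j else 0) v ∧
      HasSum (fun j => if T₂ j = k then c₂ j else 0) v := by
  obtain ⟨N₁, h₁⟩ := h₁
  obtain ⟨N₂, h₂⟩ := h₂
  apply exists_hasSum_of_sum_neg
  refine HasSum.of_eq (hasSum_slice (Sum.elim c₁ fun j => -c₂ j) (Sum.elim T₁ T₂) (min N₁ N₂)
    ?_ ?_ k)
    fun j => ?_
  · rintro (j | j) hj
    · exact (min_le_left _ _).trans (h₁ j hj)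
    · exact (min_le_right _ _).trans (h₂ j (by simpa using hj))
  · filter_upwards [h] with s hs
    obtain ⟨S, hS₁, hS₂⟩ := hs
    refine HasSum.of_eq (HasSum.sum_neg hS₁ hS₂) fun j => ?_
    rcases j with j | j <;> simp
  · rcases j with j | j
    · rfl
    · by_cases hj : T₂ j = k <;> simp [hj]

open Classical in
theorem exists_hasSum_multislice {J₁ J₂ : Type*} {M : ℕ} (c₁ : J₁ → ℂ) (E₁ : J₁ → Fin M → ℤ)
    (c₂ : J₂ → ℂ) (E₂ : J₂ → Fin M → ℤ)
    (h₁ : ∃ N, ∀ j, c₁ j ≠ 0 → ∀ r, N ≤ tail r (E₁ j))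
    (h₂ : ∃ N, ∀ j, c₂ j ≠ 0 → ∀ r, N ≤ tail r (E₂ j)) (ε : ℝ) (hε : 0 < ε)
    (h : ∀ x : Fin M → ℝ, (∀ i, 0 < x i ∧ x i < ε) → StrictAnti x →
      ∃ S, HasSum (fun j => c₁ j * ∏ i, (x i : ℂ) ^ E₁ j i) S ∧
        HasSum (fun j => c₂ j * ∏ i, (x i : ℂ) ^ E₂ j i) S) (n : Fin M → ℤ) :
    ∃ v, HasSum (fun j => if E₁ j = n then c₁ j else 0) v ∧
      HasSum (fun j => if E₂ j = n then c₂ j else 0) v := by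
  obtain ⟨N₁, h₁⟩ := h₁
  obtain ⟨N₂, h₂⟩ := h₂
  apply exists_hasSum_of_sum_neg
  refine HasSum.of_eq (hasSum_multislice M (Sum.elim c₁ fun j => -c₂ j) (Sum.elim E₁ E₂) (min N₁ N₂)
    ?_ ε hε
    ?_ n) fun j => ?_
  · rintro (j | j) hj r
    · exact (min_le_left _ _).trans (h₁ j hj r)
    · exact (min_le_right _ _).trans (h₂ j (by simpa using hj) r)
  · intro x hx hm
    obtain ⟨S, hS₁, hS₂⟩ := h x hx hm
    refine HasSum.of_eq (HasSum.sum_neg hS₁ hS₂) fun j => ?_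
    rcases j with j | j <;> simp
  · rcases j with j | j
    · rfl
    · by_cases hj : E₂ j = n <;> simp [hj]

/-- `F` has, on all of `Ω`, an absolutely convergent expansion into Laurent monomials, the
exponents being bounded below along every functional in `Λ`. -/
def Expandable {ι : Type} [Fintype ι] (Ω : Set (ι → ℂ)) (Λ : Set ((ι → ℤ) →+ ℤ))
    (F : (ι → ℂ) → ℂ) : Prop :=
  ∃ (κ : Type) (c : κ → ℂ) (E : κ → ι → ℤ), (∀ ℓ ∈ Λ, ∃ N, ∀ k, N ≤ ℓ (E k)) ∧
    ∀ τ ∈ Ω, (∀ k i, τ i = 0 → 0 ≤ E k i) ∧ HasSum (fun k => c k * ∏ i, τ i ^ E k i) (F τ)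

namespace Expandable

variable {ι : Type} [Fintype ι] {Ω : Set (ι → ℂ)} {Λ : Set ((ι → ℤ) →+ ℤ)} {F G : (ι → ℂ) → ℂ}

theorem congr (h : Expandable Ω Λ F) (hFG : ∀ τ ∈ Ω, F τ = G τ) : Expandable Ω Λ G := by
  obtain ⟨κ, c, E, hE, h⟩ := h
  exact ⟨κ, c, E, hE, fun τ hτ => ⟨(h τ hτ).1, hFG τ hτ ▸ (h τ hτ).2⟩⟩

theorem const (a : ℂ) : Expandable Ω Λ fun _ => a :=
  ⟨Unit, fun _ => a, fun _ _ => 0, fun ℓ _ => ⟨ℓ 0, fun _ => le_rfl⟩, fun τ _ =>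
    ⟨fun _ _ _ => le_rfl, by simp⟩⟩

theorem coord [DecidableEq ι] (i : ι) : Expandable Ω Λ fun τ => τ i := by
  refine ⟨Unit, fun _ => 1, fun _ => Pi.single i 1, fun ℓ _ => ⟨_, fun _ => le_rfl⟩, fun τ _ =>
    ⟨fun _ j _ => ?_, ?_⟩⟩
  · rcases eq_or_ne j i with rfl | hj
    · simp
    · simp [hj]
  · have : (∏ j, τ j ^ (Pi.single i 1 : ι → ℤ) j) = τ i := by
      rw [Fintype.prod_eq_single i fun j hj => by simp [hj]]
      simp
    simp [this]

theorem add (hF : Expandable Ω Λ F) (hG : Expandable Ω Λ G) :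
    Expandable Ω Λ fun τ => F τ + G τ := by
  obtain ⟨κ₁, c₁, E₁, hE₁, h₁⟩ := hF
  obtain ⟨κ₂, c₂, E₂, hE₂, h₂⟩ := hG
  refine ⟨κ₁ ⊕ κ₂, Sum.elim c₁ c₂, Sum.elim E₁ E₂, fun ℓ hℓ => ?_, fun τ hτ => ⟨?_, ?_⟩⟩
  · obtain ⟨N₁, hN₁⟩ := hE₁ ℓ hℓ
    obtain ⟨N₂, hN₂⟩ := hE₂ ℓ hℓ
    exact ⟨min N₁ N₂, Sum.rec (fun k => (min_le_left _ _).trans (hN₁ k))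
      fun k => (min_le_right _ _).trans (hN₂ k)⟩
  · exact Sum.rec (h₁ τ hτ).1 (h₂ τ hτ).1
  · exact HasSum.sum (f := fun k => Sum.elim c₁ c₂ k * ∏ i, τ i ^ Sum.elim E₁ E₂ k i)
      (h₁ τ hτ).2 (h₂ τ hτ).2

theorem mul (hF : Expandable Ω Λ F) (hG : Expandable Ω Λ G) :
    Expandable Ω Λ fun τ => F τ * G τ := by
  obtain ⟨κ₁, c₁, E₁, hE₁, h₁⟩ := hF
  obtain ⟨κ₂, c₂, E₂, hE₂, h₂⟩ := hG
  refine ⟨κ₁ × κ₂, fun k => c₁ k.1 * c₂ k.2, fun k => E₁ k.1 + E₂ k.2, fun ℓ hℓ => ?_,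
    fun τ hτ => ⟨?_, ?_⟩⟩
  · obtain ⟨N₁, hN₁⟩ := hE₁ ℓ hℓ
    obtain ⟨N₂, hN₂⟩ := hE₂ ℓ hℓ
    exact ⟨N₁ + N₂, fun k => by rw [map_add]; exact add_le_add (hN₁ _) (hN₂ _)⟩
  · exact fun k i hi => add_nonneg ((h₁ τ hτ).1 k.1 i hi) ((h₂ τ hτ).1 k.2 i hi)
  · have s₁ := (h₁ τ hτ).2
    have s₂ := (h₂ τ hτ).2
    have s₃ := summable_mul_of_summable_norm s₁.summable.norm s₂.summable.norm
    refine HasSum.of_eq (s₁.mul s₂ s₃) fun k => ?_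
    have : ∀ i, τ i ^ (E₁ k.1 + E₂ k.2) i = τ i ^ E₁ k.1 i * τ i ^ E₂ k.2 i := by
      intro i
      rcases eq_or_ne (τ i) 0 with hi | hi
      · have a := (h₁ τ hτ).1 k.1 i hi
        have b := (h₂ τ hτ).1 k.2 i hi
        lift E₁ k.1 i to ℕ using a with n hn
        lift E₂ k.2 i to ℕ using b with n' hn'
        rw [Pi.add_apply, ← hn, ← hn', ← Nat.cast_add, zpow_natCast, zpow_natCast, zpow_natCast,
          pow_add]
      · exact zpow_add₀ hi _ _
    simp only [this, Finset.prod_mul_distrib]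
    ring

theorem neg (hF : Expandable Ω Λ F) : Expandable Ω Λ fun τ => -F τ :=
  ((const (-1)).mul hF).congr fun τ _ => by ring

theorem pow (hF : Expandable Ω Λ F) (n : ℕ) : Expandable Ω Λ fun τ => F τ ^ n := by
  induction n with
  | zero => simpa using const 1
  | succ n ih => simpa only [pow_succ] using ih.mul hF

theorem finprod {α : Type*} (s : Finset α) {F : α → (ι → ℂ) → ℂ}
    (hF : ∀ a ∈ s, Expandable Ω Λ (F a)) : Expandable Ω Λ fun τ => ∏ a ∈ s, F a τ := by
  classical
  induction s using Finset.induction_on with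
  | empty => simpa using const 1
  | insert a s ha ih =>
    simp only [Finset.prod_insert ha]
    exact (hF a (by simp)).mul (ih fun b hb => hF b (by simp [hb]))

theorem mvPolynomial_eval {σ : Type*} (P : MvPolynomial σ ℂ) {z : (ι → ℂ) → σ → ℂ}
    (hz : ∀ i, Expandable Ω Λ fun τ => z τ i) :
    Expandable Ω Λ fun τ => MvPolynomial.eval (z τ) P := by
  induction P using MvPolynomial.induction_on with
  | C a => simpa using const a
  | add p q hp hq => simpa using hp.add hq
  | mul_X p i hp => simpa using hp.mul (hz i)

theorem inv_sub_sum [DecidableEq ι] {J : Type} [Fintype J] (p : ι) (β : J → ℂ) (e : J → ι → ℕ)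
    (hΛ : ∀ ℓ ∈ Λ, ∀ j, ℓ (Pi.single p 1) ≤ ℓ fun i => (e j i : ℤ))
    (hΩ : ∀ τ ∈ Ω, ∑ j, ‖β j * ∏ i, τ i ^ e j i‖ < ‖τ p‖) :
    Expandable Ω Λ fun τ => (τ p - ∑ j, β j * ∏ i, τ i ^ e j i)⁻¹ := by
  refine ⟨Σ n : ℕ, Fin n → J, fun k => ∏ i, β (k.2 i),
    fun k l => ((∑ i, e (k.2 i) l : ℕ) : ℤ) - (k.1 + 1) * (Pi.single p 1 : ι → ℤ) l,
    fun ℓ hℓ => ⟨- ℓ (Pi.single p 1), fun k => ?_⟩, fun τ hτ => ?_⟩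
  · have hE : (fun l => ((∑ i, e (k.2 i) l : ℕ) : ℤ) - (k.1 + 1) * (Pi.single p 1 : ι → ℤ) l) =
        (∑ i, fun l => (e (k.2 i) l : ℤ)) - ((k.1 : ℤ) + 1) • (Pi.single p 1 : ι → ℤ) := by
      funext l
      simp
    refine le_of_le_of_eq ?_ (congrArg ℓ hE).symm
    rw [map_sub, map_sum, map_zsmul]
    have := Finset.card_nsmul_le_sum Finset.univ (fun i => ℓ fun l => (e (k.2 i) l : ℤ)) _
      fun i _ => hΛ ℓ hℓ (k.2 i)
    simp only [Finset.card_univ, Fintype.card_fin, nsmul_eq_mul] at this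
    rw [zsmul_eq_mul]
    push_cast
    linarith
  · have hb := hΩ τ hτ
    set b : J → ℂ := fun j => β j * ∏ i, τ i ^ e j i with hbdef
    have hp : 0 < ‖τ p‖ := (Finset.sum_nonneg fun j _ => norm_nonneg (b j)).trans_lt hb
    have hp0 : τ p ≠ 0 := norm_pos_iff.mp hp
    refine ⟨fun k i hi => ?_, ?_⟩
    · have hip : i ≠ p := by rintro rfl; exact hp0 hi
      simp only [Pi.single_eq_of_ne hip, mul_zero, sub_zero]
      positivity
    · have term : ∀ k : Σ n : ℕ, Fin n → J,
          (∏ i, β (k.2 i)) * ∏ l, τ l ^ (((∑ i, e (k.2 i) l : ℕ) : ℤ)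
          - (k.1 + 1) * (Pi.single p 1 : ι → ℤ) l) = (∏ i, b (k.2 i)) * (τ p)⁻¹ ^ (k.1 + 1) := by
        intro k
        have h1 : ∀ l, τ l ^ (((∑ i, e (k.2 i) l : ℕ) : ℤ) - (k.1 + 1) * (Pi.single p 1 : ι → ℤ) l)
            = (∏ i, τ l ^ e (k.2 i) l) * if l = p then (τ p)⁻¹ ^ (k.1 + 1) else 1 := by
          intro l
          rw [Finset.prod_pow_eq_pow_sum]
          rcases eq_or_ne l p with rfl | hl
          · rw [zpow_sub₀ hp0, zpow_natCast, if_pos rfl, Pi.single_eq_same, mul_one, inv_pow,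
              div_eq_mul_inv]
            norm_cast
          · simp only [Pi.single_eq_of_ne hl, mul_zero, sub_zero, zpow_natCast, if_neg hl, mul_one]
        simp only [h1, Finset.prod_mul_distrib, Finset.prod_ite_eq', Finset.mem_univ, if_true,
          hbdef]
        rw [Finset.prod_comm]
        ring
      refine HasSum.of_eq (f := fun k : Σ n : ℕ, Fin n → J =>
        (∏ i, b (k.2 i)) * (τ p)⁻¹ ^ (k.1 + 1)) ?_ term
      have fib : ∀ n, HasSum (fun g : Fin n → J => (∏ i, b (g i)) * (τ p)⁻¹ ^ (n + 1))
          ((∑ j, b j) ^ n * (τ p)⁻¹ ^ (n + 1)) := by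
        intro n
        rw [Fintype.sum_pow, Finset.sum_mul]
        exact hasSum_fintype _
      have fibn : ∀ n, HasSum (fun g : Fin n → J => ‖(∏ i, b (g i)) * (τ p)⁻¹ ^ (n + 1)‖)
          ((∑ j, ‖b j‖) ^ n * ‖τ p‖⁻¹ ^ (n + 1)) := by
        intro n
        rw [Fintype.sum_pow, Finset.sum_mul]
        simp only [norm_mul, norm_prod, norm_pow, norm_inv]
        exact hasSum_fintype _
      have hs : Summable fun k : Σ n : ℕ, Fin n → J => (∏ i, b (k.2 i)) * (τ p)⁻¹ ^ (k.1 + 1) := by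
        refine Summable.of_norm ((summable_sigma_of_nonneg fun _ => norm_nonneg _).mpr
          ⟨fun n => (fibn n).summable, ?_⟩)
        simp only [fun n => (fibn n).tsum_eq]
        have hr : (∑ j, ‖b j‖) * ‖τ p‖⁻¹ < 1 := by
          rw [← div_eq_mul_inv]
          exact (div_lt_one hp).mpr hb
        have h0 : 0 ≤ (∑ j, ‖b j‖) * ‖τ p‖⁻¹ := by positivity
        have hg := (summable_geometric_of_lt_one h0 hr).mul_right ‖τ p‖⁻¹
        refine hg.congr fun n => ?_
        rw [mul_pow]
        ring
      refine HasSum.sigma_of_hasSum ?_ fib hs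
      have hr : ‖(∑ j, b j) * (τ p)⁻¹‖ < 1 := by
        rw [norm_mul, norm_inv, ← div_eq_mul_inv]
        exact (div_lt_one hp).mpr ((norm_sum_le _ _).trans_lt hb)
      have hg := (hasSum_geometric_of_norm_lt_one hr).mul_right (τ p)⁻¹
      have hv : (1 - (∑ j, b j) * (τ p)⁻¹)⁻¹ * (τ p)⁻¹ = (τ p - ∑ j, b j)⁻¹ := by
        rw [← mul_inv]
        congr 1
        field_simp
      rw [hv] at hg
      refine HasSum.of_eq hg fun n => ?_
      rw [mul_pow]
      ring

theorem inv_linear [DecidableEq ι] {J : Type} [Fintype J] (p : ι) (β : J → ℂ) (q : J → Option ι)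
    (hΛ : ∀ ℓ ∈ Λ, ∀ j, ℓ (Pi.single p 1) ≤ (q j).elim 0 fun i => ℓ (Pi.single i 1))
    (hΩ : ∀ τ ∈ Ω, ∑ j, ‖β j * (q j).elim 1 τ‖ < ‖τ p‖) :
    Expandable Ω Λ fun τ => (τ p - ∑ j, β j * (q j).elim 1 τ)⁻¹ := by
  have key : ∀ (τ : ι → ℂ) (o : Option ι),
      ∏ i, τ i ^ (o.elim 0 fun l => Pi.single l 1 : ι → ℕ) i = o.elim 1 τ := by
    rintro τ (_ | l)
    · simp
    · rw [Fintype.prod_eq_single l fun i hi => by simp [hi]]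
      simp
  have := inv_sub_sum (Ω := Ω) (Λ := Λ) p β (fun j => (q j).elim 0 fun l => Pi.single l 1)
    (fun ℓ hℓ j => (hΛ ℓ hℓ j).trans_eq ?_) (by simpa only [key] using hΩ)
  · simpa only [key] using this
  · rcases q j with _ | l
    · exact (map_zero ℓ).symm
    · refine congrArg ℓ ?_
      funext i
      rcases eq_or_ne i l with rfl | hi <;> simp [*]

theorem diagRatFn_eval {σ : Type} [Fintype σ] [DecidableEq σ] (R : DiagRatFn σ)
    {z : (ι → ℂ) → σ → ℂ} (hz : ∀ i, Expandable Ω Λ fun τ => z τ i)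
    (hinv : ∀ i j, i ≠ j → Expandable Ω Λ fun τ => (z τ i - z τ j)⁻¹) :
    Expandable Ω Λ fun τ => R.eval (z τ) := by
  refine ((mvPolynomial_eval R.num hz).mul (finprod Finset.univ.offDiag fun q hq =>
    (hinv q.1 q.2 (Finset.mem_offDiag.mp hq).2.2).pow (R.b q.1 q.2))).congr fun τ _ => ?_
  simp only [DiagRatFn.eval, div_eq_mul_inv, inv_pow, Finset.prod_inv_distrib]

theorem ratFn_eval {σ : Type} [Fintype σ] [DecidableEq σ] (R : RatFn σ)
    {z : (ι → ℂ) → σ → ℂ} (hz : ∀ i, Expandable Ω Λ fun τ => z τ i)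
    (hinv₀ : ∀ i, Expandable Ω Λ fun τ => (z τ i)⁻¹)
    (hinv : ∀ i j, i ≠ j → Expandable Ω Λ fun τ => (z τ i - z τ j)⁻¹) :
    Expandable Ω Λ fun τ => R.eval (z τ) := by
  refine ((mvPolynomial_eval R.num hz).mul ((finprod Finset.univ fun i _ =>
    (hinv₀ i).pow (R.a i)).mul (finprod Finset.univ.offDiag fun q hq =>
    (hinv q.1 q.2 (Finset.mem_offDiag.mp hq).2.2).pow (R.b q.1 q.2)))).congr fun τ _ => ?_
  simp only [RatFn.eval, div_eq_mul_inv, inv_pow, Finset.prod_inv_distrib, mul_inv]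

/-- It suffices to invert one of the two differences of each pair. -/
theorem inv_sub_symm {a b : (ι → ℂ) → ℂ} (h : Expandable Ω Λ fun τ => (a τ - b τ)⁻¹) :
    Expandable Ω Λ fun τ => (b τ - a τ)⁻¹ :=
  h.neg.congr fun τ _ => by rw [← inv_neg, neg_sub]

end Expandable

theorem tail_succ {n : ℕ} (r : Fin n) (e : Fin (n + 1) → ℤ) :
    tail r.succ e = tail r (Fin.tail e) := by
  rw [tail_apply, tail_apply, Fin.sum_univ_succ]
  simp [Fin.tail]

theorem tail_zero {n : ℕ} (e : Fin (n + 1) → ℤ) : tail 0 e = ∑ i, e i := by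
  simp [tail_apply]

namespace Expandable

variable {ι : Type} [Fintype ι] [DecidableEq ι] {Ω : Set (ι → ℂ)} {Λ : Set ((ι → ℤ) →+ ℤ)}

theorem inv_coord (p : ι) (hΛ : ∀ τ ∈ Ω, 0 < ‖τ p‖) : Expandable Ω Λ fun τ => (τ p)⁻¹ := by
  have := inv_linear (Ω := Ω) (Λ := Λ) (J := Empty) p Empty.elim Empty.elim
    (fun _ _ j => j.elim) (by simpa using hΛ)
  simpa using this

theorem inv_add_mul (p q : ι) (β : ℂ) (hΛ : ∀ ℓ ∈ Λ, ℓ (Pi.single p 1) ≤ ℓ (Pi.single q 1))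
    (hΩ : ∀ τ ∈ Ω, ‖β * τ q‖ < ‖τ p‖) : Expandable Ω Λ fun τ => (τ p - β * τ q)⁻¹ := by
  have := inv_linear (Ω := Ω) (Λ := Λ) (J := Unit) p (fun _ => β) (fun _ => some q)
    (fun ℓ hℓ _ => hΛ ℓ hℓ) (by simpa using hΩ)
  simpa using this

theorem inv_sub (p q : ι) (hΛ : ∀ ℓ ∈ Λ, ℓ (Pi.single p 1) ≤ ℓ (Pi.single q 1))
    (hΩ : ∀ τ ∈ Ω, ‖τ q‖ < ‖τ p‖) : Expandable Ω Λ fun τ => (τ p - τ q)⁻¹ := by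
  simpa using inv_add_mul p q 1 hΛ (by simpa using hΩ)

theorem inv_add (p q : ι) (hΛ : ∀ ℓ ∈ Λ, ℓ (Pi.single p 1) ≤ ℓ (Pi.single q 1))
    (hΩ : ∀ τ ∈ Ω, ‖τ q‖ < ‖τ p‖) : Expandable Ω Λ fun τ => (τ p + τ q)⁻¹ := by
  simpa using inv_add_mul p q (-1) hΛ (by simpa using hΩ)

theorem inv_sub_sub (p q q' : ι) (hΛ : ∀ ℓ ∈ Λ, ℓ (Pi.single p 1) ≤ ℓ (Pi.single q 1))
    (hΛ' : ∀ ℓ ∈ Λ, ℓ (Pi.single p 1) ≤ ℓ (Pi.single q' 1))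
    (hΩ : ∀ τ ∈ Ω, ‖τ q‖ + ‖τ q'‖ < ‖τ p‖) : Expandable Ω Λ fun τ => (τ p - (τ q + τ q'))⁻¹ := by
  have := inv_linear (Ω := Ω) (Λ := Λ) (J := Fin 2) p (fun _ => 1) ![some q, some q']
    (fun ℓ hℓ j => by
      fin_cases j
      · exact hΛ ℓ hℓ
      · exact hΛ' ℓ hℓ) (by simpa using hΩ)
  simpa using this

theorem inv_add_sub_const (p q : ι) (a : ℂ) (hΛ : ∀ ℓ ∈ Λ, ℓ (Pi.single p 1) ≤ ℓ (Pi.single q 1))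
    (hΛ' : ∀ ℓ ∈ Λ, ℓ (Pi.single p 1) ≤ 0)
    (hΩ : ∀ τ ∈ Ω, ‖τ q‖ + ‖a‖ < ‖τ p‖) : Expandable Ω Λ fun τ => (τ p + τ q - a)⁻¹ := by
  have := inv_linear (Ω := Ω) (Λ := Λ) (J := Fin 2) p ![-1, a] ![some q, none]
    (fun ℓ hℓ j => by
      fin_cases j
      · exact hΛ ℓ hℓ
      · exact hΛ' ℓ hℓ) (by simpa using hΩ)
  refine this.congr fun τ _ => ?_
  simp only [Fin.sum_univ_two, Matrix.cons_val_zero, Matrix.cons_val_one, Option.elim_some,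
    Option.elim_none]
  congr 1
  ring

end Expandable

/-- The negative of a coordinate functional. -/
def negCoord {n : ℕ} (i : Fin n) : (Fin n → ℤ) →+ ℤ := -Pi.evalAddMonoidHom (fun _ => ℤ) i

theorem negCoord_apply {n : ℕ} (i : Fin n) (e : Fin n → ℤ) : negCoord i e = -e i := rfl

theorem expandable_outer (m : ℕ) (R : RatFn (Fin (m + 1))) :
    Expandable {τ : Fin (m + 2) → ℂ | OrderedPos (Fin.tail τ) ∧ ‖τ 1‖ < ‖τ 0‖ ∧
        ∀ i : Fin m, ‖τ 1‖ + ‖τ i.succ.succ‖ < ‖τ 0‖}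
      (insert (negCoord 0) (Set.range fun r : Fin m => tail r.succ.succ))
      fun τ => R.eval (Fin.cons (τ 0) fun i : Fin m => τ 1 + τ i.succ.succ) := by
  have h1 : ∀ (τ : Fin (m + 2) → ℂ), OrderedPos (Fin.tail τ) → ∀ i : Fin m,
      ‖τ i.succ.succ‖ < ‖τ 1‖ := fun τ hτ i => hτ.1 0 i.succ (Fin.succ_pos i)
  have hr : ∀ r : Fin m, ¬ r.succ.succ ≤ (1 : Fin (m + 2)) := fun r h => by
    simp [Fin.le_def] at h
  have hd : ∀ i : Fin m, Expandable {τ : Fin (m + 2) → ℂ | OrderedPos (Fin.tail τ) ∧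
      ‖τ 1‖ < ‖τ 0‖ ∧ ∀ i : Fin m, ‖τ 1‖ + ‖τ i.succ.succ‖ < ‖τ 0‖}
      (insert (negCoord 0) (Set.range fun r : Fin m => tail r.succ.succ))
      fun τ => (τ 0 - (τ 1 + τ i.succ.succ))⁻¹ := by
    intro i
    refine Expandable.inv_sub_sub 0 1 i.succ.succ ?_ ?_ fun τ hτ => hτ.2.2 i
    · rintro ℓ (rfl | ⟨r, rfl⟩)
      · simp [negCoord_apply]
      · simp only [tail_single, hr, Fin.succ_ne_zero, Fin.le_zero_iff, if_false, le_refl]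
    · rintro ℓ (rfl | ⟨r, rfl⟩)
      · simp [negCoord_apply]
      · simp only [tail_single]
        split_ifs <;> simp_all
  have hij : ∀ i j : Fin m, i < j → Expandable {τ : Fin (m + 2) → ℂ | OrderedPos (Fin.tail τ) ∧
      ‖τ 1‖ < ‖τ 0‖ ∧ ∀ i : Fin m, ‖τ 1‖ + ‖τ i.succ.succ‖ < ‖τ 0‖}
      (insert (negCoord 0) (Set.range fun r : Fin m => tail r.succ.succ))
      fun τ => (τ 1 + τ i.succ.succ - (τ 1 + τ j.succ.succ))⁻¹ := by
    intro i j hlt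
    simp only [add_sub_add_left_eq_sub]
    refine Expandable.inv_sub i.succ.succ j.succ.succ ?_ fun τ hτ =>
      hτ.1.1 i.succ j.succ (by simpa using hlt)
    rintro ℓ (rfl | ⟨r, rfl⟩)
    · simp [negCoord_apply]
    · simp only [tail_single, Fin.succ_le_succ_iff]
      split_ifs with h1 h2
      · rfl
      · exact absurd (h1.trans hlt.le) h2
      · simp
      · rfl
  refine Expandable.ratFn_eval R ?_ ?_ ?_
  · refine Fin.cases (Expandable.coord 0) fun i => ?_
    exact (Expandable.coord 1).add (Expandable.coord i.succ.succ)
  · refine Fin.cases (Expandable.inv_coord 0 fun τ hτ => (norm_nonneg _).trans_lt hτ.2.1)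
      fun i => ?_
    refine Expandable.inv_add 1 i.succ.succ ?_ fun τ hτ => h1 τ hτ.1 i
    rintro ℓ (rfl | ⟨r, rfl⟩)
    · simp [negCoord_apply]
    · simp only [tail_single, hr, if_false]
      split_ifs <;> simp
  · refine Fin.cases (Fin.cases (fun h => absurd rfl h) fun j _ => hd j) fun i =>
      Fin.cases (fun _ => (hd i).inv_sub_symm) fun j hne => ?_
    rcases lt_or_gt_of_ne (fun h => hne (congrArg Fin.succ h) : i ≠ j) with h | h
    · exact hij i j h
    · exact (hij j i h).inv_sub_symm

theorem expandable_inner (m : ℕ) (R : RatFn (Fin (m + 1))) :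
    Expandable {τ : Fin (m + 2) → ℂ | OrderedPos τ} (Set.range tail)
      fun τ => R.eval fun i : Fin (m + 1) => τ 0 + τ i.succ := by
  have hij : ∀ i j : Fin (m + 1), i < j → Expandable {τ : Fin (m + 2) → ℂ | OrderedPos τ}
      (Set.range tail) fun τ => (τ 0 + τ i.succ - (τ 0 + τ j.succ))⁻¹ := by
    intro i j hlt
    simp only [add_sub_add_left_eq_sub]
    refine Expandable.inv_sub i.succ j.succ ?_ fun τ hτ => hτ.1 i.succ j.succ (by simpa using hlt)
    rintro ℓ ⟨r, rfl⟩
    have : i.succ ≤ j.succ := by simpa using hlt.le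
    simp only [tail_single]
    split_ifs with h1 h2
    · rfl
    · exact absurd (h1.trans this) h2
    · simp
    · rfl
  refine Expandable.ratFn_eval R (fun i => (Expandable.coord 0).add (Expandable.coord i.succ))
    (fun i => ?_) fun i j hne => ?_
  · refine Expandable.inv_add 0 i.succ ?_ fun τ hτ => hτ.1 0 i.succ (Fin.succ_pos i)
    rintro ℓ ⟨r, rfl⟩
    simp only [tail_single]
    split_ifs <;> simp_all
  · rcases lt_or_gt_of_ne hne with h | h
    · exact hij i j h
    · exact (hij j i h).inv_sub_symm

theorem expandable_diag (m n : ℕ) (R : DiagRatFn (Fin (m + n))) (zt : Fin n → ℂ) :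
    Expandable {τ : Fin (m + 1) → ℂ | Ordered (Fin.tail τ) ∧
        (∀ (i : Fin m) (j : Fin n), ‖τ i.succ‖ + ‖zt j‖ < ‖τ 0‖)}
      (insert (-tail 0) (Set.range fun r : Fin m => tail r.succ))
      fun τ => R.eval (Fin.append (fun i : Fin m => τ 0 + τ i.succ) zt) := by
  have hij : ∀ i j : Fin m, i < j → Expandable {τ : Fin (m + 1) → ℂ | Ordered (Fin.tail τ) ∧
        (∀ (i : Fin m) (j : Fin n), ‖τ i.succ‖ + ‖zt j‖ < ‖τ 0‖)}
      (insert (-tail 0) (Set.range fun r : Fin m => tail r.succ))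
      fun τ => (τ 0 + τ i.succ - (τ 0 + τ j.succ))⁻¹ := by
    intro i j hlt
    simp only [add_sub_add_left_eq_sub]
    refine Expandable.inv_sub i.succ j.succ ?_ fun τ hτ => hτ.1 i j hlt
    rintro ℓ (rfl | ⟨r, rfl⟩)
    · simp [tail_single]
    · simp only [tail_single, Fin.succ_le_succ_iff]
      split_ifs with h1 h2
      · rfl
      · exact absurd (h1.trans hlt.le) h2
      · simp
      · rfl
  have hc : ∀ (i : Fin m) (j : Fin n), Expandable {τ : Fin (m + 1) → ℂ | Ordered (Fin.tail τ) ∧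
        (∀ (i : Fin m) (j : Fin n), ‖τ i.succ‖ + ‖zt j‖ < ‖τ 0‖)}
      (insert (-tail 0) (Set.range fun r : Fin m => tail r.succ))
      fun τ => (τ 0 + τ i.succ - zt j)⁻¹ := by
    intro i j
    refine Expandable.inv_add_sub_const 0 i.succ (zt j) ?_ ?_ fun τ hτ => hτ.2 i j
    · rintro ℓ (rfl | ⟨r, rfl⟩)
      · simp [tail_single]
      · simp only [tail_single]
        split_ifs <;> simp_all
    · rintro ℓ (rfl | ⟨r, rfl⟩)
      · simp [tail_single]
      · simp [tail_single]
  refine Expandable.diagRatFn_eval R ?_ ?_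
  · refine Fin.addCases (fun i => ?_) fun j => ?_
    · simpa only [Fin.append_left] using (Expandable.coord 0).add (Expandable.coord i.succ)
    · simpa only [Fin.append_right] using Expandable.const (zt j)
  · refine Fin.addCases (fun i => Fin.addCases (fun j hne => ?_) fun j _ => ?_)
      fun i => Fin.addCases (fun j _ => ?_) fun j _ => ?_
    · simp only [Fin.append_left]
      rcases lt_or_gt_of_ne (fun h => hne (congrArg _ h) : i ≠ j) with h | h
      · exact hij i j h
      · exact (hij j i h).inv_sub_symm
    · simpa only [Fin.append_left, Fin.append_right] using hc i j
    · simpa only [Fin.append_left, Fin.append_right] using (hc j i).inv_sub_symm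
    · simpa only [Fin.append_right] using Expandable.const (zt i - zt j)⁻¹

/-- `compApply` for linear operators, as a linear operator. -/
def compLin {M : Type*} [AddCommGroup M] [Module ℂ M] :
    (n : ℕ) → (Fin n → M →ₗ[ℂ] M) → M →ₗ[ℂ] M
  | 0, _ => LinearMap.id
  | n + 1, L => L 0 ∘ₗ compLin n fun i => L i.succ

theorem compLin_apply {M : Type*} [AddCommGroup M] [Module ℂ M] (n : ℕ) (L : Fin n → M →ₗ[ℂ] M)
    (w : M) : compLin n L w = compApply n (fun i x => L i x) w := by
  induction n with
  | zero => rfl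
  | succ n ih => simp only [compLin, compApply, LinearMap.comp_apply, ih]

namespace CGrading

variable {W : Type*} [AddCommGroup W] [Module ℂ W] (G : CGrading W)

theorem proj_proj (m n : ℂ) (w : W) : G.proj m (G.proj n w) = if m = n then G.proj n w else 0 := by
  have h := congrArg (fun T : W →ₗ[ℂ] W => T w) (G.proj_comp m n)
  split_ifs with hmn <;> simpa [hmn] using h

theorem sum_proj (w : W) : ∑ n ∈ (G.proj_finite w).toFinset, G.proj n w = w := by
  rw [← finsum_eq_sum _ (G.proj_finite w), G.proj_sum]

theorem proj_d (n : ℂ) (w : W) : G.proj n (G.d w) = n • G.proj n w := by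
  have hs : (Function.support fun m => m • G.proj m w).Finite :=
    (G.proj_finite w).subset fun m hm h0 => hm (by simp [show G.proj m w = 0 from h0])
  rw [CGrading.d, finsum_eq_sum _ hs, map_sum]
  simp only [map_smul, proj_proj, smul_ite, smul_zero, Finset.sum_ite_eq]
  split_ifs with h
  · rfl
  · by_contra h0
    exact h (hs.mem_toFinset.mpr (Ne.symm h0))

theorem d_of_proj {n : ℂ} {w : W} (h : G.proj n w = w) : G.d w = n • w := by
  rw [CGrading.d, finsum_eq_single _ n]
  · rw [h]
  · intro m hm
    rw [← h, proj_proj, if_neg hm, smul_zero]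

/-- `L` changes weights only by elements of `T`. -/
def ShiftBy (T : Set ℂ) (L : W →ₗ[ℂ] W) : Prop :=
  ∀ r w, G.proj r (L w) ≠ 0 → ∃ t ∈ T, G.proj (r - t) w ≠ 0

variable {G}

open Pointwise

theorem ShiftBy.comp {T₁ T₂ : Set ℂ} {L₁ L₂ : W →ₗ[ℂ] W} (h₁ : G.ShiftBy T₁ L₁)
    (h₂ : G.ShiftBy T₂ L₂) : G.ShiftBy (T₁ + T₂) (L₁ ∘ₗ L₂) := by
  intro r w h
  obtain ⟨t₁, ht₁, h⟩ := h₁ _ _ h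
  obtain ⟨t₂, ht₂, h⟩ := h₂ _ _ h
  exact ⟨t₁ + t₂, Set.add_mem_add ht₁ ht₂, by rwa [← sub_sub]⟩

theorem ShiftBy.compLin {n : ℕ} {T : Fin n → Set ℂ} {L : Fin n → W →ₗ[ℂ] W}
    (h : ∀ i, G.ShiftBy (T i) (L i)) : G.ShiftBy (∑ i, T i) (compLin n L) := by
  induction n with
  | zero => exact fun r w h => ⟨0, by simp, by rw [sub_zero]; exact h⟩
  | succ n ih =>
    rw [Fin.sum_univ_succ]
    exact (h 0).comp (ih fun i => h i.succ)

theorem ShiftBy.mono {T T' : Set ℂ} {L : W →ₗ[ℂ] W} (h : G.ShiftBy T L) (hT : T ⊆ T') :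
    G.ShiftBy T' L := fun r w hr => by
  obtain ⟨t, ht, h'⟩ := h r w hr
  exact ⟨t, hT ht, h'⟩

theorem exists_support {φ : W →ₗ[ℂ] ℂ} {w : W} (h : φ w ≠ 0) :
    ∃ n ∈ Function.support fun n => φ ∘ₗ G.proj n, φ (G.proj n w) ≠ 0 := by
  by_contra! hn
  apply h
  rw [← G.sum_proj w, map_sum]
  refine Finset.sum_eq_zero fun n _ => ?_
  by_contra h0
  exact h0 (hn n fun h1 => h0 (DFunLike.congr_fun h1 w))

theorem ShiftBy.support_subset {T : Set ℂ} {L : W →ₗ[ℂ] W} (h : G.ShiftBy T L) (φ : W →ₗ[ℂ] ℂ) :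
    (Function.support fun n => (φ ∘ₗ L) ∘ₗ G.proj n) ⊆
      (Function.support fun n => φ ∘ₗ G.proj n) - T := by
  intro q hq
  obtain ⟨w, hw⟩ : ∃ w, φ (L (G.proj q w)) ≠ 0 := by
    by_contra! hn
    exact hq (LinearMap.ext hn)
  obtain ⟨r, hr, hr'⟩ := exists_support (G := G) hw
  obtain ⟨t, ht, h'⟩ := h r (G.proj q w) fun h0 => hr' (by rw [h0, map_zero])
  rw [proj_proj] at h'
  have : r - t = q := by
    by_contra hne
    exact h' (if_neg hne)
  exact ⟨r, hr, t, ht, this⟩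

theorem ShiftBy.inGradedDual {T : Set ℂ} {L : W →ₗ[ℂ] W} (h : G.ShiftBy T L) (hT : T.Finite)
    {φ : W →ₗ[ℂ] ℂ} (hφ : InGradedDual G.proj φ) : InGradedDual G.proj (φ ∘ₗ L) :=
  (Set.Finite.sub hφ hT).subset (h.support_subset φ)

theorem apply_eq_sum {φ : W →ₗ[ℂ] ℂ} {S : Finset ℂ}
    (hS : (Function.support fun n => φ ∘ₗ G.proj n) ⊆ S) (w : W) :
    φ w = ∑ n ∈ S, φ (G.proj n w) := by
  conv_lhs => rw [← G.sum_proj w, map_sum]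
  refine Finset.sum_congr_of_eq_on_inter (fun n _ hn => ?_) (fun n _ hn => ?_) fun _ _ _ => rfl
  · by_contra h
    exact hn (hS fun h0 => h (DFunLike.congr_fun h0 w))
  · have : G.proj n w = 0 := by simpa using hn
    rw [this, map_zero]

theorem pair_eq_sum {φ : W →ₗ[ℂ] ℂ} {S : Finset ℂ}
    (hS : (Function.support fun n => φ ∘ₗ G.proj n) ⊆ S) (f : G.Comp) :
    G.pair φ f = ∑ n ∈ S, φ (f.1 n) := by
  rw [CGrading.pair, finsum_eq_sum_of_support_subset]
  refine fun n hn => hS fun h0 => hn ?_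
  have := DFunLike.congr_fun h0 (f.1 n)
  simpa [f.2 n] using this

theorem ShiftBy.pair_ext {T : Set ℂ} {L : W →ₗ[ℂ] W} (h : G.ShiftBy T L) (hT : T.Finite)
    {φ : W →ₗ[ℂ] ℂ} (hφ : InGradedDual G.proj φ) (f : G.Comp) :
    G.pair φ (G.ext (fun w => L w) f) = G.pair (φ ∘ₗ L) f := by
  have hS' : ((Function.support fun n => φ ∘ₗ G.proj n) - T).Finite := Set.Finite.sub hφ hT
  have hS : (Function.support fun n => φ ∘ₗ G.proj n).Finite := hφ
  rw [pair_eq_sum (S := hS.toFinset) (by rw [Set.Finite.coe_toFinset]),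
    pair_eq_sum (S := hS'.toFinset) (by simpa using h.support_subset φ)]
  have key : ∀ r ∈ hS.toFinset, (G.ext (fun w => L w) f).1 r =
      ∑ n ∈ hS'.toFinset, G.proj r (L (f.1 n)) := by
    intro r hr
    refine finsum_eq_sum_of_support_subset _ fun n hn => ?_
    obtain ⟨t, ht, h'⟩ := h r (f.1 n) hn
    rw [← f.2 n, proj_proj] at h'
    have : r - t = n := by
      by_contra hne
      exact h' (if_neg hne)
    rw [Set.Finite.coe_toFinset]
    exact ⟨r, hS.mem_toFinset.mp hr, t, ht, this⟩
  rw [Finset.sum_congr rfl fun r hr => by rw [key r hr, map_sum], Finset.sum_comm]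
  refine Finset.sum_congr rfl fun n _ => ?_
  rw [LinearMap.comp_apply, ← apply_eq_sum (by rw [Set.Finite.coe_toFinset])]

theorem pair_compApply {n : ℕ} {T : Fin n → Set ℂ} {L : Fin n → W →ₗ[ℂ] W}
    (h : ∀ i, G.ShiftBy (T i) (L i)) (hT : ∀ i, (T i).Finite) {φ : W →ₗ[ℂ] ℂ}
    (hφ : InGradedDual G.proj φ) (f : G.Comp) :
    G.pair φ (compApply n (fun i => G.ext fun w => L i w) f) = G.pair (φ ∘ₗ VA.compLin n L) f := by
  induction n generalizing φ with
  | zero => rfl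
  | succ n ih =>
    rw [compApply, (h 0).pair_ext (hT 0) hφ, ih (fun i => h i.succ) (fun i => hT i.succ)
      ((h 0).inGradedDual (hT 0) hφ)]
    rfl

end CGrading

namespace ZGrading

variable {V : Type*} [AddCommGroup V] [Module ℂ V] (G : ZGrading V)

theorem proj_proj (m n : ℤ) (w : V) : G.proj m (G.proj n w) = if m = n then G.proj n w else 0 := by
  have h := congrArg (fun T : V →ₗ[ℂ] V => T w) (G.proj_comp m n)
  split_ifs with hmn <;> simpa [hmn] using h

theorem sum_proj (w : V) : ∑ n ∈ (G.proj_finite w).toFinset, G.proj n w = w := by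
  rw [← finsum_eq_sum _ (G.proj_finite w), G.proj_sum]

theorem exists_proj_ne_zero {w : V} (h : w ≠ 0) : ∃ n, G.proj n w ≠ 0 := by
  by_contra! hn
  exact h (by rw [← G.sum_proj w]; exact Finset.sum_eq_zero fun n _ => hn n)

theorem proj_d (n : ℤ) (w : V) : G.proj n (G.d w) = (n : ℂ) • G.proj n w := by
  have hs : (Function.support fun m : ℤ => (m : ℂ) • G.proj m w).Finite :=
    (G.proj_finite w).subset fun m hm h0 => hm (by simp [show G.proj m w = 0 from h0])
  rw [ZGrading.d, finsum_eq_sum _ hs, map_sum]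
  simp only [map_smul, proj_proj, smul_ite, smul_zero, Finset.sum_ite_eq]
  split_ifs with h
  · rfl
  · by_contra h0
    exact h (hs.mem_toFinset.mpr (Ne.symm h0))

theorem d_of_proj {n : ℤ} {w : V} (h : G.proj n w = w) : G.d w = (n : ℂ) • w := by
  rw [ZGrading.d, finsum_eq_single _ n]
  · rw [h]
  · intro m hm
    rw [← h, proj_proj, if_neg hm, smul_zero]

end ZGrading

section

variable {V : Type*} [AddCommGroup V] [Module ℂ V]
variable {W : Type*} [AddCommGroup W] [Module ℂ W] {A : MOSVA V}

namespace MOSVA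

theorem proj_Y_of_proj (A : MOSVA V) {p q : ℤ} {u v : V} (hu : A.gr.proj p u = u)
    (hv : A.gr.proj q v = v) {r k : ℤ} (h : A.gr.proj r (A.Y u v k) ≠ 0) : r = p - k - 1 + q := by
  have h1 := A.d_comm u v k
  rw [A.gr.d_of_proj hu, A.gr.d_of_proj hv] at h1
  simp only [map_smul, LinearMap.smul_apply, Pi.smul_apply] at h1
  have h2 := A.gr.proj_d r (A.Y u v k)
  rw [h1] at h2
  simp only [map_add, map_smul] at h2
  have h3 : ((r : ℂ) - (p - k - 1 + q)) • A.gr.proj r (A.Y u v k) = 0 := by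
    rw [sub_smul, ← h2]
    module
  have := sub_eq_zero.mp ((smul_eq_zero.mp h3).resolve_right h)
  exact_mod_cast this

theorem exists_of_proj_Y (A : MOSVA V) {u v : V} {r k : ℤ} (h : A.gr.proj r (A.Y u v k) ≠ 0) :
    ∃ p q, A.gr.proj p u ≠ 0 ∧ A.gr.proj q v ≠ 0 ∧ r = p - k - 1 + q := by
  obtain ⟨p, hp⟩ : ∃ p, A.gr.proj r (A.Y (A.gr.proj p u) v k) ≠ 0 := by
    by_contra! hn
    rw [← A.gr.sum_proj u] at h
    simp only [map_sum, LinearMap.sum_apply, Finset.sum_apply] at h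
    exact h (Finset.sum_eq_zero fun p _ => hn p)
  obtain ⟨q, hq⟩ : ∃ q, A.gr.proj r (A.Y (A.gr.proj p u) (A.gr.proj q v) k) ≠ 0 := by
    by_contra! hn
    rw [← A.gr.sum_proj v] at hp
    simp only [map_sum, Finset.sum_apply] at hp
    exact hp (Finset.sum_eq_zero fun q _ => hn q)
  refine ⟨p, q, fun h0 => hq (by simp [h0]), fun h0 => hq (by simp [h0]), ?_⟩
  exact A.proj_Y_of_proj (by rw [ZGrading.proj_proj, if_pos rfl])
    (by rw [ZGrading.proj_proj, if_pos rfl]) hq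

theorem d_vac (A : MOSVA V) : A.gr.d A.vac = 0 := by
  have h := A.d_comm A.vac A.vac (-1)
  rw [A.creation_lim, A.creation_lim, A.identity] at h
  simpa using h

theorem eq_zero_of_proj_vac (A : MOSVA V) {n : ℤ} (h : A.gr.proj n A.vac ≠ 0) : n = 0 := by
  have h1 := A.gr.proj_d n A.vac
  rw [A.d_vac, map_zero] at h1
  exact_mod_cast (smul_eq_zero.mp h1.symm).resolve_right h

/-- The vector `(Y_V)_{K 0}(u 0) ⋯ (Y_V)_{K (m-1)}(u (m-1)) 𝟏`. -/
def prodVac (A : MOSVA V) {m : ℕ} (u : Fin m → V) (K : Fin m → ℤ) : V :=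
  compApply m (fun i y => A.Y (u i) y (K i)) A.vac

theorem prodVac_succ (A : MOSVA V) {m : ℕ} (u : Fin (m + 1) → V) (K : Fin (m + 1) → ℤ) :
    A.prodVac u K = A.Y (u 0) (A.prodVac (Fin.tail u) (Fin.tail K)) (K 0) := rfl

theorem exists_of_proj_prodVac (A : MOSVA V) {m : ℕ} (u : Fin m → V) (K : Fin m → ℤ) {r : ℤ}
    (h : A.gr.proj r (A.prodVac u K) ≠ 0) :
    ∃ p : Fin m → ℤ, (∀ i, A.gr.proj (p i) (u i) ≠ 0) ∧ r = ∑ i, (p i - K i - 1) := by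
  induction m generalizing r with
  | zero => exact ⟨Fin.elim0, fun i => i.elim0, by simpa using A.eq_zero_of_proj_vac h⟩
  | succ m ih =>
    rw [prodVac_succ] at h
    obtain ⟨p, q, hp, hq, hr⟩ := A.exists_of_proj_Y h
    obtain ⟨p', hp', hq'⟩ := ih _ _ hq
    refine ⟨Fin.cons p p', Fin.cases hp hp', ?_⟩
    rw [Fin.sum_univ_succ, hr, hq']
    simp [Fin.tail]

theorem prodVac_tail_bound (A : MOSVA V) {m : ℕ} (u : Fin m → V) :
    ∃ N : ℤ, ∀ K, A.prodVac u K ≠ 0 → ∀ r : Fin m, N ≤ tail r fun i => -K i - 1 := by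
  induction m with
  | zero => exact ⟨0, fun K _ r => r.elim0⟩
  | succ m ih =>
    obtain ⟨N, hN⟩ := ih (Fin.tail u)
    obtain ⟨C, hC⟩ := A.gr.lower_bound
    have hb : ∀ i, ∃ b : ℤ, ∀ p, A.gr.proj p (u i) ≠ 0 → p ≤ b := fun i => by
      obtain ⟨b, hb⟩ := (A.gr.proj_finite (u i)).bddAbove
      exact ⟨b, fun p hp => hb hp⟩
    choose b hb using hb
    refine ⟨min N (C - ∑ i, b i), fun K hK r => ?_⟩
    induction r using Fin.cases with
    | zero =>
      obtain ⟨n, hn⟩ := A.gr.exists_proj_ne_zero hK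
      obtain ⟨p, hp, hnp⟩ := A.exists_of_proj_prodVac u K hn
      have hCn : C ≤ n := by
        by_contra! hlt
        exact hn (by simp [hC n hlt])
      have hpb : ∑ i, p i ≤ ∑ i, b i := Finset.sum_le_sum fun i _ => hb i _ (hp i)
      have : ∑ i, (p i - K i - 1) = ∑ i, p i + ∑ i, (-K i - 1) := by
        rw [← Finset.sum_add_distrib]
        exact Finset.sum_congr rfl fun i _ => by ring
      rw [tail_zero]
      exact (min_le_right _ _).trans (by linarith)
    | succ r =>
      rw [tail_succ]
      refine (min_le_left _ _).trans (hN (Fin.tail K) (fun h0 => hK ?_) r)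
      rw [prodVac_succ, h0]
      simp

/-- The sums of weights occurring in the homogeneous decompositions of the `u i`. -/
def wtSums (A : MOSVA V) {m : ℕ} (u : Fin m → V) : Set ℂ :=
  (fun p : Fin m → ℤ => ((∑ i, p i : ℤ) : ℂ)) '' {p | ∀ i, A.gr.proj (p i) (u i) ≠ 0}

theorem wtSums_finite (A : MOSVA V) {m : ℕ} (u : Fin m → V) : (A.wtSums u).Finite := by
  refine Set.Finite.image _ ?_
  have := Set.Finite.pi' fun i => A.gr.proj_finite (u i)
  exact this

end MOSVA

namespace Bimod

/-- The coefficient `(Y_W^L)_k(u)` as a linear operator. -/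
def YLk (B : Bimod A W) (u : V) (k : ℤ) : W →ₗ[ℂ] W := LinearMap.proj k ∘ₗ B.YL u

theorem YLk_apply (B : Bimod A W) (u : V) (w : W) (k : ℤ) : B.YLk u k w = B.YL u w k := rfl

theorem proj_YL_of_proj (B : Bimod A W) {p : ℤ} {q : ℂ} {u : V} {w : W}
    (hu : A.gr.proj p u = u) (hw : B.gr.proj q w = w) {r : ℂ} {k : ℤ}
    (h : B.gr.proj r (B.YL u w k) ≠ 0) : r = p - k - 1 + q := by
  have h1 := B.d_commL u w k
  rw [A.gr.d_of_proj hu, B.gr.d_of_proj hw] at h1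
  simp only [map_smul, LinearMap.smul_apply, Pi.smul_apply] at h1
  have h2 := B.gr.proj_d r (B.YL u w k)
  rw [h1] at h2
  simp only [map_add, map_smul] at h2
  have h3 : (r - (p - k - 1 + q)) • B.gr.proj r (B.YL u w k) = 0 := by
    rw [sub_smul, ← h2]
    module
  exact sub_eq_zero.mp ((smul_eq_zero.mp h3).resolve_right h)

theorem shiftBy_YLk (B : Bimod A W) (u : V) (k : ℤ) :
    B.gr.ShiftBy ((fun p : ℤ => (p - k - 1 : ℂ)) '' {p | A.gr.proj p u ≠ 0}) (B.YLk u k) := by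
  intro r w h
  rw [YLk_apply] at h
  obtain ⟨p, hp⟩ : ∃ p, B.gr.proj r (B.YL (A.gr.proj p u) w k) ≠ 0 := by
    by_contra! hn
    rw [← A.gr.sum_proj u] at h
    simp only [map_sum, LinearMap.sum_apply, Finset.sum_apply] at h
    exact h (Finset.sum_eq_zero fun p _ => hn p)
  obtain ⟨q, hq⟩ : ∃ q, B.gr.proj r (B.YL (A.gr.proj p u) (B.gr.proj q w) k) ≠ 0 := by
    by_contra! hn
    rw [← B.gr.sum_proj w] at hp
    simp only [map_sum, Finset.sum_apply] at hp
    exact hp (Finset.sum_eq_zero fun q _ => hn q)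
  have hr : r = p - k - 1 + q := B.proj_YL_of_proj
    (by rw [ZGrading.proj_proj, if_pos rfl]) (by rw [CGrading.proj_proj, if_pos rfl]) hq
  refine ⟨_, ⟨p, fun h0 => hp (by simp [h0]), rfl⟩, ?_⟩
  rw [hr, add_sub_cancel_left]
  exact fun h0 => hq (by simp [h0])

theorem finite_shift (u : V) (k : ℤ) :
    ((fun p : ℤ => (p - k - 1 : ℂ)) '' {p | A.gr.proj p u ≠ 0}).Finite :=
  (A.gr.proj_finite u).image _

theorem inGradedDual_comp (B : Bimod A W) (u : V) (k : ℤ) {φ : W →ₗ[ℂ] ℂ}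
    (hφ : InGradedDual B.gr.proj φ) : InGradedDual B.gr.proj (φ ∘ₗ B.YLk u k) :=
  (B.shiftBy_YLk u k).inGradedDual (finite_shift u k) hφ

theorem shiftBy_prod (B : Bimod A W) {m : ℕ} (u : Fin m → V) (K : Fin m → ℤ) :
    B.gr.ShiftBy ((fun t => t - (∑ i, K i : ℤ) - m) '' A.wtSums u)
      (compLin m fun i => B.YLk (u i) (K i)) := by
  refine (CGrading.ShiftBy.compLin fun i => B.shiftBy_YLk (u i) (K i)).mono ?_
  intro t ht
  rw [Set.mem_finsetSum] at ht
  obtain ⟨g, hg, rfl⟩ := ht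
  choose p hp hpg using fun i => hg (Finset.mem_univ i)
  refine ⟨_, ⟨p, hp, rfl⟩, ?_⟩
  simp only [← hpg, Finset.sum_sub_distrib]
  simp

theorem shiftBy_iterate (B : Bimod A W) {m : ℕ} (u : Fin m → V) (K : Fin m → ℤ) (k : ℤ) :
    B.gr.ShiftBy ((fun t => t - ((∑ i, K i) + k + 1 : ℤ) - m) '' A.wtSums u)
      (B.YLk (A.prodVac u K) k) := by
  refine (B.shiftBy_YLk _ k).mono ?_
  rintro _ ⟨r, hr, rfl⟩
  obtain ⟨p, hp, rfl⟩ := A.exists_of_proj_prodVac u K hr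
  refine ⟨_, ⟨p, hp, rfl⟩, ?_⟩
  simp only [Finset.sum_sub_distrib]
  push_cast
  simp
  ring

theorem exists_truncate (B : Bimod A W) {m : ℕ} (u : Fin m → V) {φ : W →ₗ[ℂ] ℂ}
    (hφ : InGradedDual B.gr.proj φ) (g : B.gr.Comp) (D : ℤ) :
    ∃ w : W, (∀ K : Fin m → ℤ, ∑ i, K i = D →
        B.gr.pair φ (compApply m (fun i => B.gr.ext fun x => B.YL (u i) x (K i)) g) =
          φ (compApply m (fun i x => B.YL (u i) x (K i)) w)) ∧
      ∀ (K : Fin m → ℤ) (k : ℤ), ∑ i, K i + k + 1 = D →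
        B.gr.pair φ (B.gr.ext (fun x => B.YL (A.prodVac u K) x k) g) =
          φ (B.YL (A.prodVac u K) w k) := by
  have hT : ((fun t : ℂ => t - (D : ℤ) - m) '' A.wtSums u).Finite := (A.wtSums_finite u).image _
  have hS := Set.Finite.sub hφ hT
  refine ⟨∑ q ∈ hS.toFinset, g.1 q, fun K hK => ?_, fun K k hK => ?_⟩
  · have h := B.gr.pair_compApply (fun i => B.shiftBy_YLk (u i) (K i))
      (fun i => finite_shift (u i) (K i)) hφ g
    refine h.trans ?_
    have hs := (B.shiftBy_prod u K).support_subset φ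
    rw [hK] at hs
    rw [CGrading.pair_eq_sum (S := hS.toFinset) (by rwa [Set.Finite.coe_toFinset]), ← map_sum,
      LinearMap.comp_apply, compLin_apply]
    rfl
  · refine ((B.shiftBy_YLk _ k).pair_ext (finite_shift _ k) hφ g).trans ?_
    have hs := (B.shiftBy_iterate u K k).support_subset φ
    rw [hK] at hs
    rw [CGrading.pair_eq_sum (S := hS.toFinset) (by rwa [Set.Finite.coe_toFinset]), ← map_sum]
    rfl

theorem exists_level_bound (B : Bimod A W) {φ : W →ₗ[ℂ] ℂ} (hφ : InGradedDual B.gr.proj φ)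
    {T : Set ℂ} (hT : T.Finite) (m : ℕ) :
    ∃ D₀ : ℤ, ∀ (D : ℤ) (L : W →ₗ[ℂ] W), B.gr.ShiftBy ((fun t => t - D - m) '' T) L →
      ∀ w, φ (L w) ≠ 0 → D₀ ≤ D := by
  obtain ⟨C, hC⟩ := B.gr.lower_bound
  have hfin : ((fun p : ℂ × ℂ => p.1.re - p.2.re) ''
      ((Function.support fun n => φ ∘ₗ B.gr.proj n) ×ˢ T)).Finite :=
    (Set.Finite.prod hφ hT).image _
  obtain ⟨M, hM⟩ := hfin.bddAbove
  refine ⟨⌊C - M - m⌋, fun D L hL w hw => ?_⟩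
  obtain ⟨r, hr, hr'⟩ := CGrading.exists_support (G := B.gr) hw
  obtain ⟨_, ⟨t, ht, rfl⟩, h'⟩ := hL r w fun h0 => hr' (by rw [h0, map_zero])
  have h1 : C ≤ (r - (t - D - m)).re := by
    by_contra! hlt
    exact h' (by simp [hC _ hlt])
  have h2 : r.re - t.re ≤ M := hM ⟨(r, t), ⟨hr, ht⟩, rfl⟩
  simp only [Complex.sub_re, Complex.intCast_re, Complex.natCast_re] at h1
  have h3 : C - M - m ≤ D := by linarith
  exact_mod_cast (Int.floor_le _).trans h3

theorem exists_prod_bound (B : Bimod A W) {m : ℕ} (u : Fin m → V) {φ : W →ₗ[ℂ] ℂ}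
    (hφ : InGradedDual B.gr.proj φ) :
    ∃ D₀ : ℤ, (∀ (K : Fin m → ℤ) (w : W),
        φ (compApply m (fun i x => B.YL (u i) x (K i)) w) ≠ 0 → D₀ ≤ ∑ i, K i) ∧
      ∀ (K : Fin m → ℤ) (k : ℤ) (w : W), φ (B.YL (A.prodVac u K) w k) ≠ 0 →
        D₀ ≤ ∑ i, K i + k + 1 := by
  obtain ⟨D₀, h⟩ := B.exists_level_bound hφ (A.wtSums_finite u) m
  refine ⟨D₀, fun K w hw => h _ _ (B.shiftBy_prod u K) w ?_, fun K k w hw =>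
    h _ _ (B.shiftBy_iterate u K k) w hw⟩
  rwa [compLin_apply]

theorem exists_YL_bound (B : Bimod A W) (u : V) {φ : W →ₗ[ℂ] ℂ}
    (hφ : InGradedDual B.gr.proj φ) :
    ∃ N : ℤ, ∀ (k : ℤ) (w : W), φ (B.YL u w k) ≠ 0 → N ≤ k := by
  obtain ⟨N, h, _⟩ := B.exists_prod_bound (fun _ : Fin 1 => u) hφ
  exact ⟨N, fun k w hw => by simpa using h (fun _ => k) w hw⟩

end Bimod

end

theorem exists_uniform_bound {α β : Type*} [Finite α] {g : α → β → ℤ}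
    (h : ∀ a, ∃ N, ∀ b, N ≤ g a b) : ∃ N, ∀ a b, N ≤ g a b := by
  choose N hN using h
  obtain ⟨M, hM⟩ := (Set.finite_range N).bddBelow
  exact ⟨M, fun a b => (hM ⟨a, rfl⟩).trans (hN a b)⟩

theorem hasSum_reindex {J J' : Type*} {f : J → ℂ} {p : J → Prop} [DecidablePred p] (i : J' → J)
    (hi : Function.Injective i) (hp : ∀ j', p (i j')) (hr : ∀ j, p j → j ∈ Set.range i) {v : ℂ}
    (h : HasSum (fun j => if p j then f j else 0) v) : HasSum (fun j' => f (i j')) v := by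
  have h1 := (hi.hasSum_iff (f := fun j => if p j then f j else 0) (a := v)
    fun j hj => if_neg fun hpj => hj (hr j hpj)).mpr h
  exact HasSum.of_eq h1 fun j' => by simp [hp]

theorem HasSum.slice_mul {J K : Type*} [DecidableEq K] {f : J → ℂ} {g : J → K} {k : K} {v : ℂ}
    (h : HasSum (fun j => if g j = k then f j else 0) v) (a : K → ℂ) :
    HasSum (fun j => if g j = k then f j * a (g j) else 0) (v * a k) := by
  refine HasSum.of_eq (h.mul_right (a k)) fun j => ?_
  split_ifs with hj
  · rw [hj]
  · simp

/-- A series of monomials may be regrouped by collecting equal exponents. -/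
theorem hasSum_of_fibers {κ Q : Type*} {n : ℕ} {α : κ → ℂ} {E : κ → Fin n → ℤ}
    (e : Q ≃ (Fin n → ℤ)) {c : Q → ℂ}
    (hc : ∀ q, HasSum (fun k => if E k = e q then α k else 0) (c q)) {τ : Fin n → ℂ} {S : ℂ}
    (h : HasSum (fun k => α k * ∏ i, τ i ^ E k i) S) :
    HasSum (fun q => c q * ∏ i, τ i ^ e q i) S := by
  classical
  refine hasSum_fiberwise h (fun k => e.symm (E k)) fun q => ?_
  have h1 := HasSum.slice_mul (hc q) fun n : Fin n → ℤ => ∏ i, τ i ^ n i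
  refine HasSum.of_eq h1 fun k => ?_
  simp only [Equiv.symm_apply_eq]

theorem hasSum_fibers_of_multislice {κ Q : Type*} {n : ℕ} {α : κ → ℂ} {E : κ → Fin n → ℤ}
    (e : Q ≃ (Fin n → ℤ)) {c : Q → ℂ}
    (h₁ : ∃ N, ∀ q, c q ≠ 0 → ∀ r, N ≤ tail r (e q))
    (h₂ : ∃ N, ∀ k, α k ≠ 0 → ∀ r, N ≤ tail r (E k)) (ε : ℝ) (hε : 0 < ε)
    (h : ∀ x : Fin n → ℝ, (∀ i, 0 < x i ∧ x i < ε) → StrictAnti x →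
      ∃ S, HasSum (fun q => c q * ∏ i, (x i : ℂ) ^ e q i) S ∧
        HasSum (fun k => α k * ∏ i, (x i : ℂ) ^ E k i) S) (q : Q) :
    HasSum (fun k => if E k = e q then α k else 0) (c q) := by
  obtain ⟨v, hv₁, hv₂⟩ := exists_hasSum_multislice c e α E h₁ h₂ ε hε h (e q)
  have : HasSum (fun _ : Unit => c q) v := hasSum_reindex (p := fun q' => e q' = e q)
    (fun _ : Unit => q) (Function.injective_of_subsingleton _) (fun _ => rfl)
    (fun q' hq' => ⟨(), (e.injective hq').symm⟩) hv₁
  rwa [this.unique (hasSum_unique fun _ : Unit => c q)] at hv₂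

/-- The exponents of the variables `(ζ, x)` in the iterate. -/
def expEquiv (m : ℕ) : (Fin m → ℤ) × ℤ ≃ (Fin (m + 1) → ℤ) where
  toFun Q := Fin.cons (-Q.2 - 1) fun i => -Q.1 i - 1
  invFun n := (fun i => -n i.succ - 1, -n 0 - 1)
  left_inv Q := by simp
  right_inv n := by
    funext i
    refine Fin.cases ?_ (fun i => ?_) i <;> simp

@[simp] theorem expEquiv_zero {m : ℕ} (Q : (Fin m → ℤ) × ℤ) : expEquiv m Q 0 = -Q.2 - 1 := rfl

@[simp] theorem expEquiv_succ {m : ℕ} (Q : (Fin m → ℤ) × ℤ) (i : Fin m) :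
    expEquiv m Q i.succ = -Q.1 i - 1 := rfl

section

variable {V : Type*} [AddCommGroup V] [Module ℂ V]
variable {W : Type*} [AddCommGroup W] [Module ℂ W] {A : MOSVA V}

namespace Bimod

/-- The matrix coefficients of a product of vertex operators. -/
def prodCoeff (B : Bimod A W) {m : ℕ} (u : Fin m → V) (w : W) (φ : W →ₗ[ℂ] ℂ)
    (K : Fin m → ℤ) : ℂ := φ (compApply m (fun i x => B.YL (u i) x (K i)) w)

/-- The matrix coefficients of an iterate of vertex operators. -/
def iterCoeff (B : Bimod A W) {m : ℕ} (u : Fin m → V) (w : W) (φ : W →ₗ[ℂ] ℂ)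
    (Q : (Fin m → ℤ) × ℤ) : ℂ := φ (B.YL (A.prodVac u Q.1) w Q.2)

/-- The product and the iterate converge to the same value at the point `y = (ζ, x)`. -/
def ProdEqIter (B : Bimod A W) {m : ℕ} (u : Fin m → V) (w : W) (φ : W →ₗ[ℂ] ℂ)
    (y : Fin (m + 1) → ℝ) : Prop :=
  ∃ S, HasSum (fun K => B.prodCoeff u w φ K * ∏ i, ((y 0 : ℂ) + y i.succ) ^ (-K i - 1)) S ∧
    HasSum (fun Q => B.iterCoeff u w φ Q * ∏ i, (y i : ℂ) ^ expEquiv m Q i) S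

theorem iterCoeff_tail_bound (B : Bimod A W) {m : ℕ} (u : Fin m → V) :
    ∃ N : ℤ, ∀ (w : W) (φ : W →ₗ[ℂ] ℂ) (Q : (Fin m → ℤ) × ℤ), B.iterCoeff u w φ Q ≠ 0 →
      ∀ r : Fin m, N ≤ tail r fun i => -Q.1 i - 1 := by
  obtain ⟨N, hN⟩ := A.prodVac_tail_bound u
  refine ⟨N, fun w φ Q hQ r => hN Q.1 (fun h0 => hQ ?_) r⟩
  simp [iterCoeff, h0]

theorem prodEqIter_zero (B : Bimod A W) (u : Fin 0 → V) (w : W) (φ : W →ₗ[ℂ] ℂ)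
    (y : Fin 1 → ℝ) : B.ProdEqIter u w φ y := by
  refine ⟨φ w, ?_, ?_⟩
  · refine HasSum.of_eq (hasSum_unique fun _ : Fin 0 → ℤ => φ w) fun K => ?_
    simp [prodCoeff, compApply]
  · have : HasSum _ _ := hasSum_single (f := fun Q : (Fin 0 → ℤ) × ℤ => B.iterCoeff u w φ Q *
      ∏ i, (y i : ℂ) ^ expEquiv 0 Q i) (Fin.elim0, -1) (fun Q hQ => by
        have hne : Q.2 ≠ -1 := fun h => hQ (Prod.ext (Subsingleton.elim _ _) h)
        simp [iterCoeff, MOSVA.prodVac, compApply, B.identityL, hne])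
    simpa [iterCoeff, MOSVA.prodVac, compApply, B.identityL] using this

theorem strictAnti_cons {n : ℕ} {a : ℝ} {x : Fin n → ℝ} (hx : StrictAnti x) (ha : ∀ i, x i < a) :
    StrictAnti (Fin.cons a x : Fin (n + 1) → ℝ) := by
  intro i j hij
  induction i using Fin.cases with
  | zero =>
    obtain ⟨j, rfl⟩ := Fin.exists_succ_eq.mpr hij.ne'
    simpa using ha j
  | succ i =>
    obtain ⟨j, rfl⟩ := Fin.exists_succ_eq.mpr ((Fin.zero_le _).trans_lt hij).ne'
    simpa using hx (Fin.succ_lt_succ_iff.mp hij)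

theorem outer_slice (B : Bimod A W) {m : ℕ} (u : Fin (m + 1) → V) (w : W) {φ : W →ₗ[ℂ] ℂ}
    (hφ : InGradedDual B.gr.proj φ) {κ : Type*} {α : κ → ℂ} {E : κ → Fin (m + 2) → ℤ}
    (hE : ∃ N, ∀ k, N ≤ -E k 0) (y : Fin (m + 1) → ℝ)
    (IH : ∀ k₀, B.ProdEqIter (Fin.tail u) w (φ ∘ₗ B.YLk (u 0) k₀) y)
    (h : ∀ᶠ s : ℝ in 𝓝[>] 0, ∃ S,
      HasSum (fun K => B.prodCoeff u w φ K * ∏ i, (Fin.cons ((s : ℂ)⁻¹) fun i : Fin m =>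
        (y 0 : ℂ) + y i.succ : Fin (m + 1) → ℂ) i ^ (-K i - 1)) S ∧
      HasSum (fun k => α k * ∏ i, (Fin.cons ((s : ℂ)⁻¹) fun i => (y i : ℂ) :
        Fin (m + 2) → ℂ) i ^ E k i) S) (k₀ : ℤ) :
    ∃ v, HasSum (fun Q => B.iterCoeff (Fin.tail u) w (φ ∘ₗ B.YLk (u 0) k₀) Q *
        ∏ i, (y i : ℂ) ^ expEquiv m Q i) v ∧
      HasSum (fun k => (if E k 0 = -k₀ - 1 then α k else 0) * ∏ i, (y i : ℂ) ^ E k i.succ) v := by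
  classical
  obtain ⟨N, hN⟩ := B.exists_YL_bound (u 0) hφ
  set c₁ : (Fin (m + 1) → ℤ) → ℂ := fun K =>
    B.prodCoeff u w φ K * ∏ i : Fin m, ((y 0 : ℂ) + y i.succ) ^ (-K i.succ - 1) with hc₁
  set c₂ : κ → ℂ := fun k => α k * ∏ i, (y i : ℂ) ^ E k i.succ with hc₂
  have hb₁ : ∃ N : ℤ, ∀ K, c₁ K ≠ 0 → N ≤ K 0 + 1 := ⟨N + 1, fun K hK => by
    have := hN (K 0) _ (left_ne_zero_of_mul hK)
    linarith⟩
  have hb₂ : ∃ N : ℤ, ∀ k, c₂ k ≠ 0 → N ≤ -E k 0 := hE.imp fun N hN k _ => hN k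
  have hs : ∀ᶠ s : ℝ in 𝓝[>] 0, ∃ S, HasSum (fun K => c₁ K * (s : ℂ) ^ (K 0 + 1)) S ∧
      HasSum (fun k => c₂ k * (s : ℂ) ^ (-E k 0)) S := by
    filter_upwards [h] with s hs
    obtain ⟨S, hS₁, hS₂⟩ := hs
    refine ⟨S, HasSum.of_eq hS₁ fun K => ?_, HasSum.of_eq hS₂ fun k => ?_⟩
    · rw [Fin.prod_univ_succ]
      simp only [Fin.cons_zero, Fin.cons_succ, hc₁]
      rw [inv_zpow', show -(-K 0 - 1) = K 0 + 1 by ring]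
      ring
    · rw [Fin.prod_univ_succ (n := m + 1)]
      simp only [Fin.cons_zero, Fin.cons_succ, hc₂]
      rw [inv_zpow']
      ring
  obtain ⟨v, hv₁, hv₂⟩ := exists_hasSum_slice c₁ (fun K => K 0 + 1) c₂ (fun k => -E k 0)
    hb₁ hb₂ hs (k₀ + 1)
  obtain ⟨S, hS₁, hS₂⟩ := IH k₀
  have h1 : HasSum (fun K : Fin m → ℤ => c₁ (Fin.cons k₀ K)) v :=
    hasSum_reindex (f := c₁) (p := fun K => K 0 + 1 = k₀ + 1)
      (fun K : Fin m → ℤ => (Fin.cons k₀ K : Fin (m + 1) → ℤ))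
      (fun a b hab => (Fin.cons_injective2 hab).2) (fun K => by simp) (fun K hK =>
        ⟨Fin.tail K, by rw [← add_right_cancel hK]; exact Fin.cons_self_tail K⟩) hv₁
  have h2 : v = S := h1.unique (HasSum.of_eq hS₁ fun K => rfl)
  rw [← h2] at hS₂
  refine ⟨v, hS₂, HasSum.of_eq hv₂ fun k => ?_⟩
  have : E k 0 = -k₀ - 1 ↔ -E k 0 = k₀ + 1 := by constructor <;> intro h <;> linarith
  simp only [this, ite_mul, zero_mul, hc₂]

theorem outer_multislice (B : Bimod A W) {m : ℕ} (u : Fin (m + 1) → V) (w : W) (φ : W →ₗ[ℂ] ℂ)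
    {κ : Type*} {α : κ → ℂ} {E : κ → Fin (m + 2) → ℤ}
    (hE : ∃ N, ∀ k, ∀ r : Fin m, N ≤ tail r.succ.succ (E k)) (k₀ : ℤ)
    (h : ∀ y : Fin (m + 1) → ℝ, StrictAnti y → (∀ i, 0 < y i) → ∃ v,
      HasSum (fun Q => B.iterCoeff (Fin.tail u) w (φ ∘ₗ B.YLk (u 0) k₀) Q *
        ∏ i, (y i : ℂ) ^ expEquiv m Q i) v ∧
      HasSum (fun k => (if E k 0 = -k₀ - 1 then α k else 0) * ∏ i, (y i : ℂ) ^ E k i.succ) v)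
    {ζ : ℝ} (hζ : 0 < ζ) (K : Fin m → ℤ) :
    ∃ v, HasSum (fun k => B.iterCoeff (Fin.tail u) w (φ ∘ₗ B.YLk (u 0) k₀) (K, k) *
        (ζ : ℂ) ^ (-k - 1)) v ∧
      HasSum (fun k => if E k 0 = -k₀ - 1 then
        (if (fun i : Fin m => E k i.succ.succ) = (fun i => -K i - 1) then α k else 0) *
          (ζ : ℂ) ^ E k 1 else 0) v := by
  classical
  obtain ⟨N, hN⟩ := B.iterCoeff_tail_bound (Fin.tail u)
  obtain ⟨N', hN'⟩ := hE
  set c₁ : (Fin m → ℤ) × ℤ → ℂ := fun Q =>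
    B.iterCoeff (Fin.tail u) w (φ ∘ₗ B.YLk (u 0) k₀) Q * (ζ : ℂ) ^ (-Q.2 - 1) with hc₁
  set c₂ : κ → ℂ := fun k => (if E k 0 = -k₀ - 1 then α k else 0) * (ζ : ℂ) ^ E k 1 with hc₂
  have hs : ∀ x : Fin m → ℝ, (∀ i, 0 < x i ∧ x i < ζ) → StrictAnti x →
      ∃ S, HasSum (fun Q => c₁ Q * ∏ i, (x i : ℂ) ^ (-Q.1 i - 1)) S ∧
        HasSum (fun k => c₂ k * ∏ i, (x i : ℂ) ^ E k i.succ.succ) S := by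
    intro x hx hanti
    obtain ⟨v, hv₁, hv₂⟩ := h (Fin.cons ζ x) (strictAnti_cons hanti fun i => (hx i).2)
      (Fin.cases hζ fun i => (hx i).1)
    refine ⟨v, HasSum.of_eq hv₁ fun Q => ?_, HasSum.of_eq hv₂ fun k => ?_⟩
    · rw [Fin.prod_univ_succ]
      simp only [Fin.cons_zero, Fin.cons_succ, expEquiv_zero, expEquiv_succ, hc₁]
      ring
    · rw [Fin.prod_univ_succ]
      simp only [Fin.cons_zero, Fin.cons_succ, Fin.succ_zero_eq_one, hc₂]
      ring
  obtain ⟨v, hv₁, hv₂⟩ := exists_hasSum_multislice c₁ (fun Q i => -Q.1 i - 1) c₂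
    (fun k i => E k i.succ.succ) ⟨N, fun Q hQ => hN _ _ _ (left_ne_zero_of_mul hQ)⟩
    ⟨N', fun k _ r => by
      have := hN' k r
      rwa [tail_succ, tail_succ] at this⟩ ζ hζ hs (fun i => -K i - 1)
  refine ⟨v, ?_, HasSum.of_eq hv₂ fun k => ?_⟩
  · exact hasSum_reindex (f := c₁) (p := fun Q => (fun i => -Q.1 i - 1) = fun i => -K i - 1)
      (fun k : ℤ => (K, k)) (fun a b h => (Prod.ext_iff.mp h).2) (fun k => rfl)
      (fun Q hQ => ⟨Q.2, Prod.ext (funext fun i => by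
        have := congrFun hQ i
        simp only at this ⊢
        linarith) rfl⟩) hv₁
  · simp only [hc₂]
    split_ifs <;> simp

end Bimod

end

theorem orderedPos_ofReal {n : ℕ} {x : Fin n → ℝ} (hx : StrictAnti x) (hpos : ∀ i, 0 < x i) :
    OrderedPos fun i => (x i : ℂ) := by
  refine ⟨fun i j hij => ?_, fun i => ?_⟩
  · rw [Complex.norm_real, Complex.norm_real, Real.norm_of_nonneg (hpos _).le,
      Real.norm_of_nonneg (hpos _).le]
    exact hx hij
  · rw [Complex.norm_real, Real.norm_of_nonneg (hpos _).le]
    exact hpos i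

theorem norm_ofReal_of_pos {a : ℝ} (ha : 0 < a) : ‖(a : ℂ)‖ = a := by
  rw [Complex.norm_real, Real.norm_of_nonneg ha.le]

/-- The first two entries of a tuple. -/
def fstTwo {m : ℕ} (e : Fin (m + 2) → ℤ) : Fin 2 → ℤ := Fin.cons (e 0) fun _ => e 1

theorem exists_tail_fstTwo {m : ℕ} (r : Fin 2) : ∃ r' : Fin (m + 2), ∀ e : Fin (m + 2) → ℤ,
    tail r (fstTwo e) = tail r' e - ∑ i : Fin m, e i.succ.succ := by
  induction r using Fin.cases with
  | zero =>
    refine ⟨0, fun e => ?_⟩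
    rw [tail_zero, tail_zero, Fin.sum_univ_succ (n := m + 1), Fin.sum_univ_succ (n := m),
      Fin.sum_univ_two]
    simp only [fstTwo, Fin.cons_zero, Fin.cons_one, Fin.succ_zero_eq_one]
    ring
  | succ r =>
    obtain rfl : r = 0 := Subsingleton.elim _ _
    refine ⟨Fin.succ 0, fun e => ?_⟩
    rw [tail_succ, tail_succ, tail_zero, tail_zero, Fin.sum_univ_succ (n := m)]
    simp [fstTwo, Fin.tail]

theorem eq_iff_fstTwo {m : ℕ} (e e' : Fin (m + 2) → ℤ) : e = e' ↔
    fstTwo e = fstTwo e' ∧ (fun i : Fin m => e i.succ.succ) = fun i => e' i.succ.succ := by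
  constructor
  · rintro rfl
    exact ⟨rfl, rfl⟩
  · rintro ⟨h1, h2⟩
    funext i
    refine Fin.cases (by simpa [fstTwo] using congrFun h1 0)
      (fun i => Fin.cases (by simpa [fstTwo] using congrFun h1 1) (fun i => ?_) i) i
    exact congrFun h2 i

section

variable {V : Type*} [AddCommGroup V] [Module ℂ V]
variable {W : Type*} [AddCommGroup W] [Module ℂ W] {A : MOSVA V}

namespace Bimod

theorem tail_zero_expEquiv {m : ℕ} (Q : (Fin m → ℤ) × ℤ) :
    tail 0 (expEquiv m Q) = -(∑ i, Q.1 i + Q.2 + 1) - m := by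
  rw [tail_zero, Fin.sum_univ_succ]
  simp only [expEquiv_zero, expEquiv_succ, Finset.sum_sub_distrib, Finset.sum_neg_distrib]
  simp
  ring

theorem exists_iterCoeff_bound (B : Bimod A W) {m : ℕ} (u : Fin m → V) (w : W) {φ : W →ₗ[ℂ] ℂ}
    (hφ : InGradedDual B.gr.proj φ) : ∃ N : ℤ, ∀ Q, B.iterCoeff u w φ Q ≠ 0 →
      ∀ r, N ≤ tail r (expEquiv m Q) := by
  obtain ⟨N, hN⟩ := B.iterCoeff_tail_bound u
  have hfin : ((fun p : (ℂ × ℂ) × ℂ => p.1.1.re - p.1.2.re + p.2.re) ''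
      (((Function.support fun n => B.gr.proj n w) ×ˢ
        (Function.support fun n => φ ∘ₗ B.gr.proj n)) ×ˢ A.wtSums u)).Finite :=
    (Set.Finite.prod (Set.Finite.prod (B.gr.proj_finite w) hφ) (A.wtSums_finite u)).image _
  obtain ⟨M, hM⟩ := hfin.bddAbove
  refine ⟨min N ⌊-M⌋, fun Q hQ r => ?_⟩
  induction r using Fin.cases with
  | zero =>
    refine (min_le_right _ _).trans ?_
    obtain ⟨r, hr, hr'⟩ := CGrading.exists_support (G := B.gr) hQ
    obtain ⟨_, ⟨t, ht, rfl⟩, h'⟩ := B.shiftBy_iterate u Q.1 Q.2 r w fun h0 => hr' (by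
      change B.gr.proj r (B.YL (A.prodVac u Q.1) w Q.2) = 0 at h0
      rw [h0, map_zero])
    have h1 := hM ⟨((_, r), t), ⟨⟨h', hr⟩, ht⟩, rfl⟩
    simp only [Complex.sub_re, Complex.intCast_re, Complex.natCast_re] at h1
    rw [tail_zero_expEquiv]
    have h2 : (⌊-M⌋ : ℝ) ≤ -M := Int.floor_le _
    have : (⌊-M⌋ : ℝ) ≤ ((-(∑ i, Q.1 i + Q.2 + 1) - m : ℤ) : ℝ) := by
      push_cast at h1 ⊢
      linarith
    exact_mod_cast this
  | succ r =>
    rw [tail_succ]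
    exact (min_le_left _ _).trans (hN w φ Q hQ r)

end Bimod

end

theorem hasSum_of_rows {κ : Type*} {c : ℤ × ℤ → ℂ} {f : κ → ℂ} {a : κ → ℤ} {z S : ℂ}
    (hc : HasSum (fun q => c q * z ^ (-q.1 - 1)) S) (hf : Summable fun j => f j * z ^ a j)
    (h : ∀ k₀, ∃ v, HasSum (fun k => c (k₀, k)) v ∧
      HasSum (fun j => if a j = -k₀ - 1 then f j else 0) v) :
    HasSum (fun j => f j * z ^ a j) S := by
  choose v hv₁ hv₂ using h
  have h1 : HasSum (fun k₀ => v k₀ * z ^ (-k₀ - 1)) S :=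
    hc.prod_fiberwise fun k₀ => (hv₁ k₀).mul_right (z ^ (-k₀ - 1))
  have h2 : HasSum (fun k₀ => v k₀ * z ^ (-k₀ - 1)) (∑' j, f j * z ^ a j) := by
    refine hasSum_fiberwise hf.hasSum (fun j => -a j - 1) fun k₀ => ?_
    refine HasSum.of_eq ((hv₂ k₀).mul_right (z ^ (-k₀ - 1))) fun j => ?_
    have : -a j - 1 = k₀ ↔ a j = -k₀ - 1 := by constructor <;> intro h <;> linarith
    simp only [this]
    split_ifs with hj
    · rw [hj]
    · simp
  rw [h1.unique h2]
  exact hf.hasSum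

/-- Restricting a multiple Laurent series to the terms with a fixed exponent in some of the
variables preserves summability. -/
theorem summable_restrict {κ : Type*} {f g : κ → ℂ} {n : ℕ} {E : κ → Fin n → ℤ} {x : Fin n → ℝ}
    (hx : ∀ i, 0 < x i) (e : Fin n → ℤ)
    (h : Summable fun k => f k * g k * ∏ i, (x i : ℂ) ^ E k i) :
    Summable fun k => (if E k = e then f k else 0) * g k := by
  have h0 : (∏ i, (x i : ℂ) ^ e i) ≠ 0 := Finset.prod_ne_zero_iff.mpr fun i _ =>
    zpow_ne_zero _ (Complex.ofReal_ne_zero.mpr (hx i).ne')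
  have h1 := (summable_ite h (fun k => E k = e)).mul_right (∏ i, (x i : ℂ) ^ e i)⁻¹
  refine h1.congr fun k => ?_
  split_ifs with hk
  · rw [hk]
    field_simp
  · simp

theorem exists_small_strictAnti (n : ℕ) {δ : ℝ} (hδ : 0 < δ) :
    ∃ x : Fin n → ℝ, StrictAnti x ∧ ∀ i, 0 < x i ∧ x i < δ := by
  refine ⟨fun i => δ / ((i : ℕ) + 2 : ℝ), fun i j hij => ?_, fun i => ⟨by positivity, ?_⟩⟩
  · have : ((i : ℕ) : ℝ) < ((j : ℕ) : ℝ) := by exact_mod_cast hij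
    exact div_lt_div_of_pos_left hδ (by positivity) (by linarith)
  · rw [div_lt_iff₀ (by positivity)]
    have : (0 : ℝ) ≤ ((i : ℕ) : ℝ) := by positivity
    nlinarith

section

variable {V : Type*} [AddCommGroup V] [Module ℂ V]
variable {W : Type*} [AddCommGroup W] [Module ℂ W] {A : MOSVA V}

namespace Bimod

/-- The expansion of the product of `m + 1` operators in the region
`|z| > |ζ| > |x₁| > ⋯ > |xₘ|`, in the variables `(z, ζ, x)`, restricted to the coefficient of a
fixed monomial in `x`, gives the product `Y(u₀, z) Y(v, ζ) w`. -/
theorem restricted_outer (B : Bimod A W) {m : ℕ} (u : Fin (m + 1) → V) (w : W) (φ : W →ₗ[ℂ] ℂ)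
    {κ : Type*} {α : κ → ℂ} {E : κ → Fin (m + 2) → ℤ} {R : RatFn (Fin (m + 1))}
    (hS : ∀ y : Fin (m + 2) → ℝ, StrictAnti (Fin.tail y) → (∀ i, 0 < y i) → y 1 < y 0 →
      (∀ i : Fin m, y 1 + y i.succ.succ < y 0) →
      HasSum (fun k => α k * ∏ i, (y i : ℂ) ^ E k i)
        (R.eval (Fin.cons (y 0 : ℂ) fun i => (y 1 : ℂ) + y i.succ.succ)))
    (K : Fin m → ℤ)
    (h : ∀ ζ : ℝ, 0 < ζ → ∀ k₀, ∃ v,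
      HasSum (fun k => B.iterCoeff (Fin.tail u) w (φ ∘ₗ B.YLk (u 0) k₀) (K, k) *
        (ζ : ℂ) ^ (-k - 1)) v ∧
      HasSum (fun k => if E k 0 = -k₀ - 1 then
        (if (fun i : Fin m => E k i.succ.succ) = (fun i => -K i - 1) then α k else 0) *
          (ζ : ℂ) ^ E k 1 else 0) v)
    {z ζ : ℝ} (hζ : 0 < ζ) (hz : ζ < z) {S : ℂ}
    (hass : HasSum (fun k : ℤ × ℤ => φ (B.YL (u 0) (B.YL (A.prodVac (Fin.tail u) K) w k.2) k.1) *
      (z : ℂ) ^ (-k.1 - 1) * (ζ : ℂ) ^ (-k.2 - 1)) S) :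
    HasSum (fun k => (if (fun i : Fin m => E k i.succ.succ) = (fun i => -K i - 1) then α k else 0) *
      ((z : ℂ) ^ E k 0 * (ζ : ℂ) ^ E k 1)) S := by
  obtain ⟨x, hanti, hx⟩ := exists_small_strictAnti m (lt_min hζ (sub_pos.mpr hz))
  have hsum := (hS (Fin.cons z (Fin.cons ζ x))
    (by simpa using strictAnti_cons hanti fun i => (hx i).2.trans_le (min_le_left _ _))
    (Fin.cases (hζ.trans hz) (Fin.cases hζ fun i => (hx i).1)) (by simpa using hz)
    (fun i => by
      have := (hx i).2.trans_le (min_le_right _ _)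
      simp only [Fin.cons_zero, Fin.cons_one, Fin.cons_succ]
      linarith)).summable
  have hsum' : Summable fun k => (if (fun i : Fin m => E k i.succ.succ) = (fun i => -K i - 1)
      then α k else 0) * ((z : ℂ) ^ E k 0 * (ζ : ℂ) ^ E k 1) := by
    refine summable_restrict (E := fun k (i : Fin m) => E k i.succ.succ) (fun i => (hx i).1) _
      (hsum.congr fun k => ?_)
    rw [Fin.prod_univ_succ, Fin.prod_univ_succ]
    simp only [Fin.cons_zero, Fin.cons_succ, Fin.succ_zero_eq_one, Fin.cons_one]
    ring
  refine HasSum.of_eq (hasSum_of_rows (c := fun k : ℤ × ℤ =>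
      φ (B.YL (u 0) (B.YL (A.prodVac (Fin.tail u) K) w k.2) k.1) * (ζ : ℂ) ^ (-k.2 - 1))
    (f := fun k => (if (fun i : Fin m => E k i.succ.succ) = (fun i => -K i - 1) then α k else 0) *
      (ζ : ℂ) ^ E k 1) (a := fun k => E k 0) (z := z) ?_ ?_ (h ζ hζ)) fun k => by ring
  · exact HasSum.of_eq hass fun k => by ring
  · exact hsum'.congr fun k => by ring

end Bimod

end

section

variable {V : Type*} [AddCommGroup V] [Module ℂ V]
variable {W : Type*} [AddCommGroup W] [Module ℂ W] {A : MOSVA V}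

namespace Bimod

theorem iterCoeff_eq_fiber (B : Bimod A W) {m : ℕ} (u : Fin (m + 1) → V) (w : W)
    {φ : W →ₗ[ℂ] ℂ} (hφ : InGradedDual B.gr.proj φ) {κ : Type*} {α : κ → ℂ}
    {E : κ → Fin (m + 2) → ℤ} (hE : ∃ N, ∀ k r, N ≤ tail r (E k)) (K : Fin m → ℤ)
    (h : ∀ y : Fin 2 → ℝ, StrictAnti y → (∀ i, 0 < y i) → ∃ S,
      HasSum (fun k : ℤ × ℤ => φ (B.YL (A.Y (u 0) (A.prodVac (Fin.tail u) K) k.1) w k.2) *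
        (y 1 : ℂ) ^ (-k.1 - 1) * (y 0 : ℂ) ^ (-k.2 - 1)) S ∧
      HasSum (fun k => (if (fun i : Fin m => E k i.succ.succ) = (fun i => -K i - 1) then α k
        else 0) * ((y 0 : ℂ) ^ E k 0 * (y 1 : ℂ) ^ E k 1)) S) (k₀ k : ℤ) :
    HasSum (fun j => if E j = expEquiv (m + 1) (Fin.cons k₀ K, k) then α j else 0)
      (B.iterCoeff u w φ (Fin.cons k₀ K, k)) := by
  classical
  obtain ⟨N₁, hN₁⟩ := B.exists_iterCoeff_bound u w hφ
  obtain ⟨N₂, hN₂⟩ := hE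
  set c : (Fin 1 → ℤ) × ℤ → ℂ := fun Q => B.iterCoeff u w φ (Fin.cons (Q.1 0) K, Q.2) with hc
  set α' : κ → ℂ := fun k =>
    if (fun i : Fin m => E k i.succ.succ) = (fun i => -K i - 1) then α k else 0 with hα'
  have he : ∀ Q : (Fin 1 → ℤ) × ℤ,
      expEquiv 1 Q = fstTwo (expEquiv (m + 1) (Fin.cons (Q.1 0) K, Q.2)) := fun Q => by
    funext i
    fin_cases i
    · rfl
    · rfl
  have hb₁ : ∃ N, ∀ Q, c Q ≠ 0 → ∀ r, N ≤ tail r (expEquiv 1 Q) := by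
    refine ⟨N₁ - ∑ i, (-K i - 1), fun Q hQ r => ?_⟩
    obtain ⟨r', hr'⟩ := exists_tail_fstTwo (m := m) r
    rw [he, hr']
    have := hN₁ _ hQ r'
    simp only [expEquiv_succ, Fin.cons_succ]
    linarith
  have hb₂ : ∃ N, ∀ k, α' k ≠ 0 → ∀ r, N ≤ tail r (fstTwo (E k)) := by
    refine ⟨N₂ - ∑ i, (-K i - 1), fun k hk r => ?_⟩
    obtain ⟨r', hr'⟩ := exists_tail_fstTwo (m := m) r
    have hEk : (fun i : Fin m => E k i.succ.succ) = (fun i => -K i - 1) := by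
      by_contra h0
      exact hk (if_neg h0)
    rw [hr', Finset.sum_congr rfl fun i _ => congrFun hEk i]
    have := hN₂ k r'
    linarith
  have hs : ∀ x : Fin 2 → ℝ, (∀ i, 0 < x i ∧ x i < 1) → StrictAnti x →
      ∃ S, HasSum (fun Q => c Q * ∏ i, (x i : ℂ) ^ expEquiv 1 Q i) S ∧
        HasSum (fun k => α' k * ∏ i, (x i : ℂ) ^ fstTwo (E k) i) S := by
    intro x hx hanti
    obtain ⟨S, hS₁, hS₂⟩ := h x hanti fun i => (hx i).1
    refine ⟨S, ?_, HasSum.of_eq hS₂ fun k => ?_⟩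
    · have h1 := ((Equiv.funUnique (Fin 1) ℤ).prodCongr (Equiv.refl ℤ)).hasSum_iff.mpr hS₁
      refine HasSum.of_eq h1 fun Q => ?_
      rw [Fin.prod_univ_two]
      change B.iterCoeff u w φ (Fin.cons (Q.1 0) K, Q.2) *
        ((x 0 : ℂ) ^ (-Q.2 - 1) * (x 1 : ℂ) ^ (-Q.1 0 - 1)) =
        B.iterCoeff u w φ (Fin.cons (Q.1 0) K, Q.2) *
        (x 1 : ℂ) ^ (-Q.1 0 - 1) * (x 0 : ℂ) ^ (-Q.2 - 1)
      ring
    · rw [Fin.prod_univ_two]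
      rfl
  have key := hasSum_fibers_of_multislice (expEquiv 1) hb₁ hb₂ 1 one_pos hs (fun _ => k₀, k)
  refine HasSum.of_eq key fun j => ?_
  rw [he]
  simp only [hα', eq_iff_fstTwo (E j), expEquiv_succ, Fin.cons_succ]
  split_ifs <;> simp_all

theorem prodEqIter_succ (B : Bimod A W) {m : ℕ}
    (IH : ∀ (u : Fin m → V) (w : W) (φ : W →ₗ[ℂ] ℂ), InGradedDual B.gr.proj φ →
      ∀ y : Fin (m + 1) → ℝ, StrictAnti y → (∀ i, 0 < y i) → B.ProdEqIter u w φ y)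
    (u : Fin (m + 1) → V) (w : W) {φ : W →ₗ[ℂ] ℂ} (hφ : InGradedDual B.gr.proj φ)
    (y : Fin (m + 2) → ℝ) (hy : StrictAnti y) (hpos : ∀ i, 0 < y i) : B.ProdEqIter u w φ y := by
  classical
  obtain ⟨R, hR⟩ := B.rationalityL (m + 1) u w φ hφ
  obtain ⟨κ₁, α₁, E₁, hB₁, hS₁⟩ := expandable_outer m R
  obtain ⟨κ₂, α₂, E₂, hB₂, hS₂⟩ := expandable_inner m R
  have hb₂ : ∃ N, ∀ k r, N ≤ tail r (E₂ k) := by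
    obtain ⟨N, hN⟩ := exists_uniform_bound (g := fun (r : Fin (m + 2)) k => tail r (E₂ k))
      fun r => hB₂ _ ⟨r, rfl⟩
    exact ⟨N, fun k r => hN r k⟩
  have hb₁ : ∃ N, ∀ k, ∀ r : Fin m, N ≤ tail r.succ.succ (E₁ k) := by
    obtain ⟨N, hN⟩ := exists_uniform_bound (g := fun (r : Fin m) k => tail r.succ.succ (E₁ k))
      fun r => hB₁ _ (Or.inr ⟨r, rfl⟩)
    exact ⟨N, fun k r => hN r k⟩
  have hb₁' : ∃ N, ∀ k, N ≤ -E₁ k 0 := hB₁ _ (Or.inl rfl)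
  have outer : ∀ y : Fin (m + 2) → ℝ, StrictAnti (Fin.tail y) → (∀ i, 0 < y i) → y 1 < y 0 →
      (∀ i : Fin m, y 1 + y i.succ.succ < y 0) →
      HasSum (fun k => α₁ k * ∏ i, (y i : ℂ) ^ E₁ k i)
        (R.eval (Fin.cons (y 0 : ℂ) fun i => (y 1 : ℂ) + y i.succ.succ)) := by
    intro y h1 h2 h3 h4
    refine (hS₁ (fun i => (y i : ℂ)) ⟨orderedPos_ofReal h1 fun i => h2 i.succ, ?_, fun i => ?_⟩).2
    · simpa only [norm_ofReal_of_pos (h2 _)] using h3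
    · simpa only [norm_ofReal_of_pos (h2 _)] using h4 i
  have inner : ∀ y : Fin (m + 2) → ℝ, StrictAnti y → (∀ i, 0 < y i) →
      HasSum (fun k => α₂ k * ∏ i, (y i : ℂ) ^ E₂ k i)
        (R.eval fun i : Fin (m + 1) => (y 0 : ℂ) + y i.succ) := by
    intro y h1 h2
    exact (hS₂ (fun i => (y i : ℂ)) (orderedPos_ofReal h1 h2)).2
  have prod : ∀ z : Fin (m + 1) → ℝ, StrictAnti z → (∀ i, 0 < z i) →
      HasSum (fun K => B.prodCoeff u w φ K * ∏ i, (z i : ℂ) ^ (-K i - 1))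
        (R.eval fun i => (z i : ℂ)) := fun z h1 h2 =>
    (hR (fun i => (z i : ℂ)) (orderedPos_ofReal h1 h2)).2
  have slice₁ : ∀ k₀ (y : Fin (m + 1) → ℝ), StrictAnti y → (∀ i, 0 < y i) → ∃ v,
      HasSum (fun Q => B.iterCoeff (Fin.tail u) w (φ ∘ₗ B.YLk (u 0) k₀) Q *
        ∏ i, (y i : ℂ) ^ expEquiv m Q i) v ∧
      HasSum (fun k => (if E₁ k 0 = -k₀ - 1 then α₁ k else 0) *
        ∏ i, (y i : ℂ) ^ E₁ k i.succ) v := by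
    intro k₀ y hy hpos
    refine B.outer_slice u w hφ hb₁' y
      (fun k₀ => IH _ _ _ (B.inGradedDual_comp (u 0) k₀ hφ) y hy hpos) ?_ k₀
    have h0 : 0 < (2 * y 0)⁻¹ := by have := hpos 0; positivity
    filter_upwards [Ioo_mem_nhdsGT h0] with s hs
    have hs' : 2 * y 0 < s⁻¹ := (lt_inv_comm₀ hs.1 (by have := hpos 0; positivity)).mp hs.2
    have hlt : ∀ i : Fin m, y i.succ < y 0 := fun i => hy (Fin.succ_pos i)
    refine ⟨R.eval (Fin.cons ((s⁻¹ : ℝ) : ℂ) fun i : Fin m => (y 0 : ℂ) + y i.succ), ?_, ?_⟩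
    · have h1 := prod (Fin.cons s⁻¹ fun i : Fin m => y 0 + y i.succ)
        (strictAnti_cons (fun i j hij => by
          have := hy (Fin.succ_lt_succ_iff.mpr hij)
          simpa using this) fun i => by linarith [hlt i])
        (Fin.cases (inv_pos.mpr hs.1) fun i => by
          have := hpos 0
          have := hpos i.succ
          simp only [Fin.cons_succ]
          positivity)
      have h2 : (fun i => (((Fin.cons s⁻¹ fun i : Fin m => y 0 + y i.succ : Fin (m + 1) → ℝ) i : ℝ)
          : ℂ)) = Fin.cons ((s : ℂ)⁻¹) fun i : Fin m => (y 0 : ℂ) + y i.succ := by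
        funext i
        refine Fin.cases ?_ (fun i => ?_) i <;> simp
      rw [h2] at h1
      rw [Complex.ofReal_inv]
      exact HasSum.of_eq h1 fun K => by simp only [← h2]
    · have h1 := outer (Fin.cons s⁻¹ y) (by simpa using hy)
        (Fin.cases (inv_pos.mpr hs.1) hpos) (by
          simp only [Fin.cons_one, Fin.cons_zero]
          linarith [hpos 0]) fun i => by
          simp only [Fin.cons_one, Fin.cons_zero, Fin.cons_succ]
          linarith [hlt i]
      have h2 : (fun i => (((Fin.cons s⁻¹ y : Fin (m + 2) → ℝ) i : ℝ) : ℂ)) =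
          Fin.cons ((s : ℂ)⁻¹) fun i => (y i : ℂ) := by
        funext i
        refine Fin.cases ?_ (fun i => ?_) i <;> simp
      refine HasSum.of_eq h1 fun k => by simp only [← h2]
  have slice₂ := fun (K : Fin m → ℤ) (ζ : ℝ) (hζ : 0 < ζ) k₀ =>
    B.outer_multislice u w φ hb₁ k₀ (slice₁ k₀) hζ K
  have fiber : ∀ Q, HasSum (fun k => if E₂ k = expEquiv (m + 1) Q then α₂ k else 0)
      (B.iterCoeff u w φ Q) := by
    rintro ⟨K, k⟩
    rw [← Fin.cons_self_tail K]
    refine B.iterCoeff_eq_fiber u w hφ hb₂ (Fin.tail K) (fun y hy hpos => ?_) (K 0) k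
    obtain ⟨R₂, hass₁, hass₂⟩ := B.associativityL (u 0) (A.prodVac (Fin.tail u) (Fin.tail K)) w φ hφ
    have h01 : y 1 < y 0 := hy Fin.zero_lt_one
    refine ⟨R₂.eval ![(y 0 : ℂ) + y 1, y 0], ?_, ?_⟩
    · have := (hass₂ ((y 0 : ℂ) + y 1) (y 0) (by
        rw [add_sub_cancel_left, norm_ofReal_of_pos (hpos _), norm_ofReal_of_pos (hpos _)]
        exact h01) (by
        rw [add_sub_cancel_left, norm_ofReal_of_pos (hpos _)]
        exact hpos _)).2
      simpa only [add_sub_cancel_left] using this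
    · have hlt : y 0 < y 0 + y 1 := by linarith [hpos 1]
      have hp := (hass₁ ((y 0 + y 1 : ℝ) : ℂ) (y 0) (by
        rw [norm_ofReal_of_pos (hpos _), norm_ofReal_of_pos ((hpos 0).trans hlt)]
        exact hlt) (by
        rw [norm_ofReal_of_pos (hpos _)]
        exact hpos _)).2
      have hr := B.restricted_outer u w φ outer (Fin.tail K) (slice₂ (Fin.tail K)) (hpos 0) hlt hp
      have hsl := exists_hasSum_multislice
        (fun k => α₁ k * (((y 0 + y 1 : ℝ) : ℂ) ^ E₁ k 0 * (y 0 : ℂ) ^ E₁ k 1))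
        (fun k (i : Fin m) => E₁ k i.succ.succ)
        (fun k => α₂ k * ((y 0 : ℂ) ^ E₂ k 0 * (y 1 : ℂ) ^ E₂ k 1))
        (fun k (i : Fin m) => E₂ k i.succ.succ)
        (hb₁.imp fun N hN k _ r => by
          have := hN k r
          rwa [tail_succ, tail_succ] at this)
        (hb₂.imp fun N hN k _ r => by
          have := hN k r.succ.succ
          rwa [tail_succ, tail_succ] at this) (y 1) (hpos 1) (fun x hx hanti => by
          have hy' : StrictAnti (Fin.cons (y 0) (Fin.cons (y 1) x) : Fin (m + 2) → ℝ) :=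
            strictAnti_cons (strictAnti_cons hanti fun i => (hx i).2)
              (Fin.cases h01 fun i => (hx i).2.trans h01)
          have hin := inner (Fin.cons (y 0) (Fin.cons (y 1) x)) hy'
            (Fin.cases (hpos 0) (Fin.cases (hpos 1) fun i => (hx i).1))
          have hout := outer (Fin.cons (y 0 + y 1) (Fin.cons (y 0) x))
            (by simpa using strictAnti_cons hanti fun i => (hx i).2.trans h01)
            (Fin.cases ((hpos 0).trans hlt) (Fin.cases (hpos 0) fun i => (hx i).1))
            (by simpa using hpos 1) (fun i => by
              simp only [Fin.cons_one, Fin.cons_zero, Fin.cons_succ]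
              linarith [(hx i).2])
          refine ⟨_, HasSum.of_eq hout fun k => ?_, ?_⟩
          · rw [Fin.prod_univ_succ (n := m + 1), Fin.prod_univ_succ (n := m)]
            simp only [Fin.cons_zero, Fin.cons_succ, Fin.succ_zero_eq_one, Fin.cons_one]
            ring
          · have heq : (Fin.cons
                (((Fin.cons (y 0 + y 1) (Fin.cons (y 0) x) : Fin (m + 2) → ℝ) 0 : ℝ) : ℂ)
                fun i : Fin m =>
                  (((Fin.cons (y 0 + y 1) (Fin.cons (y 0) x) : Fin (m + 2) → ℝ) 1 : ℝ) : ℂ) +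
                  (((Fin.cons (y 0 + y 1) (Fin.cons (y 0) x) : Fin (m + 2) → ℝ) i.succ.succ : ℝ)
                    : ℂ) : Fin (m + 1) → ℂ) = fun i : Fin (m + 1) =>
                (((Fin.cons (y 0) (Fin.cons (y 1) x) : Fin (m + 2) → ℝ) 0 : ℝ) : ℂ) +
                  (((Fin.cons (y 0) (Fin.cons (y 1) x) : Fin (m + 2) → ℝ) i.succ : ℝ) : ℂ) := by
              funext i
              refine Fin.cases ?_ (fun i => ?_) i <;> simp
            rw [heq]
            refine HasSum.of_eq hin fun k => ?_
            rw [Fin.prod_univ_succ (n := m + 1), Fin.prod_univ_succ (n := m)]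
            simp only [Fin.cons_zero, Fin.cons_succ, Fin.succ_zero_eq_one, Fin.cons_one]
            ring) (fun i => -Fin.tail K i - 1)
      obtain ⟨v, hv₁, hv₂⟩ := hsl
      have hv : R₂.eval ![(y 0 : ℂ) + y 1, y 0] = v := by
        rw [← Complex.ofReal_add]
        refine hr.unique (HasSum.of_eq hv₁ fun k => ?_)
        split_ifs <;> simp
      rw [hv]
      refine HasSum.of_eq hv₂ fun k => ?_
      split_ifs <;> simp
  refine ⟨_, ?_, hasSum_of_fibers (expEquiv (m + 1)) fiber (inner y hy hpos)⟩
  have h1 := prod (fun i => y 0 + y i.succ) (fun i j hij => by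
      have := hy (Fin.succ_lt_succ_iff.mpr hij)
      simpa using this) fun i => add_pos (hpos _) (hpos _)
  simpa only [Complex.ofReal_add] using h1

/-- Products and iterates of vertex operators agree. -/
theorem prodEqIter (B : Bimod A W) (m : ℕ) : ∀ (u : Fin m → V) (w : W) (φ : W →ₗ[ℂ] ℂ),
    InGradedDual B.gr.proj φ → ∀ y : Fin (m + 1) → ℝ, StrictAnti y → (∀ i, 0 < y i) →
      B.ProdEqIter u w φ y := by
  induction m with
  | zero => exact fun u w φ _ y _ _ => B.prodEqIter_zero u w φ y
  | succ m ih => exact fun u w φ hφ => B.prodEqIter_succ ih u w hφ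

end Bimod

end

theorem prod_div_zpow {n : ℕ} (a : Fin n → ℂ) {s : ℂ} (hs : s ≠ 0) (e : Fin n → ℤ) :
    ∏ i, (a i / s) ^ e i = (∏ i, a i ^ e i) * s ^ (-∑ i, e i) := by
  induction n with
  | zero => simp
  | succ n ih =>
    rw [Fin.prod_univ_succ, Fin.prod_univ_succ, Fin.sum_univ_succ, ih (fun i => a i.succ), neg_add,
      zpow_add₀ hs, div_zpow]
    simp only [zpow_neg]
    ring

section

variable {V : Type*} [AddCommGroup V] [Module ℂ V]
variable {W : Type*} [AddCommGroup W] [Module ℂ W] {A : MOSVA V}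

namespace Bimod

/-- The matrix coefficients of a product of vertex operators applied to the completion. -/
def compProdCoeff (B : Bimod A W) {m : ℕ} (u : Fin m → V) (g : B.gr.Comp) (φ : W →ₗ[ℂ] ℂ)
    (K : Fin m → ℤ) : ℂ :=
  B.gr.pair φ (compApply m (fun i => B.gr.ext fun x => B.YL (u i) x (K i)) g)

/-- The matrix coefficients of an iterate of vertex operators applied to the completion. -/
def compIterCoeff (B : Bimod A W) {m : ℕ} (u : Fin m → V) (g : B.gr.Comp) (φ : W →ₗ[ℂ] ℂ)
    (Q : (Fin m → ℤ) × ℤ) : ℂ :=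
  B.gr.pair φ (B.gr.ext (fun x => B.YL (A.prodVac u Q.1) x Q.2) g)

theorem prod_terms {m : ℕ} (y : Fin (m + 1) → ℝ) {s : ℝ} (hs : s ≠ 0) (K : Fin m → ℤ) :
    ∏ i, (((y 0 / s : ℝ) : ℂ) + ((y i.succ / s : ℝ) : ℂ)) ^ (-K i - 1) =
      (∏ i, ((y 0 : ℂ) + y i.succ) ^ (-K i - 1)) * (s : ℂ) ^ (∑ i, K i + m) := by
  have h1 := prod_div_zpow (fun i : Fin m => (y 0 : ℂ) + y i.succ) (Complex.ofReal_ne_zero.mpr hs)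
    fun i => -K i - 1
  have h2 : -∑ i : Fin m, (-K i - 1) = ∑ i, K i + m := by
    simp only [Finset.sum_sub_distrib, Finset.sum_neg_distrib]
    simp
    ring
  rw [h2] at h1
  rw [← h1]
  refine Finset.prod_congr rfl fun i _ => ?_
  push_cast
  rw [add_div]

theorem monomial_terms {n : ℕ} (y : Fin (n + 1) → ℝ) {s : ℝ} (hs : s ≠ 0) (e : Fin (n + 1) → ℤ) :
    ∏ i, ((y i / s : ℝ) : ℂ) ^ e i = (∏ i, (y i : ℂ) ^ e i) * (s : ℂ) ^ (-tail 0 e) := by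
  rw [tail_zero, ← prod_div_zpow (fun i => (y i : ℂ)) (Complex.ofReal_ne_zero.mpr hs)]
  simp only [Complex.ofReal_div]

theorem level_slice (B : Bimod A W) {m : ℕ} (u : Fin m → V) {φ : W →ₗ[ℂ] ℂ}
    (hφ : InGradedDual B.gr.proj φ) (g : B.gr.Comp) (D : ℤ) {y : Fin (m + 1) → ℝ}
    (hy : StrictAnti y) (hpos : ∀ i, 0 < y i) :
    ∃ v, HasSum (fun K => if ∑ i, K i + (m : ℤ) = D + m then
        B.compProdCoeff u g φ K * ∏ i, ((y 0 : ℂ) + y i.succ) ^ (-K i - 1) else 0) v ∧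
      HasSum (fun Q => if -tail 0 (expEquiv m Q) = D + m then
        B.compIterCoeff u g φ Q * ∏ i, (y i : ℂ) ^ expEquiv m Q i else 0) v := by
  obtain ⟨w, hw₁, hw₂⟩ := B.exists_truncate u hφ g D
  obtain ⟨D₀, hD₁, hD₂⟩ := B.exists_prod_bound u hφ
  obtain ⟨v, hv₁, hv₂⟩ := exists_hasSum_slice
    (fun K => B.prodCoeff u w φ K * ∏ i, ((y 0 : ℂ) + y i.succ) ^ (-K i - 1))
    (fun K => ∑ i, K i + (m : ℤ))
    (fun Q => B.iterCoeff u w φ Q * ∏ i, (y i : ℂ) ^ expEquiv m Q i)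
    (fun Q => -tail 0 (expEquiv m Q))
    ⟨D₀ + m, fun K hK => by
      have := hD₁ K w (left_ne_zero_of_mul hK)
      linarith⟩
    ⟨D₀ + m, fun Q hQ => by
      have := hD₂ Q.1 Q.2 w (left_ne_zero_of_mul hQ)
      rw [tail_zero_expEquiv]
      linarith⟩ (by
      filter_upwards [self_mem_nhdsWithin] with s hs
      have hs : 0 < s := hs
      obtain ⟨S, hS₁, hS₂⟩ := B.prodEqIter m u w φ hφ (fun i => y i / s)
        (fun i j hij => div_lt_div_of_pos_right (hy hij) hs) fun i => div_pos (hpos i) hs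
      refine ⟨S, HasSum.of_eq hS₁ fun K => ?_, HasSum.of_eq hS₂ fun Q => ?_⟩
      · rw [prod_terms y hs.ne', mul_assoc]
      · rw [monomial_terms y hs.ne', mul_assoc]) (D + m)
  refine ⟨v, HasSum.of_eq hv₁ fun K => ?_, HasSum.of_eq hv₂ fun Q => ?_⟩
  · split_ifs with h
    · rw [compProdCoeff, hw₁ K (by linarith)]
      rfl
    · rfl
  · split_ifs with h
    · rw [tail_zero_expEquiv] at h
      rw [compIterCoeff, hw₂ Q.1 Q.2 (by linarith)]
      rfl
    · rfl

theorem compProdCoeff_bound (B : Bimod A W) {m : ℕ} (u : Fin m → V) {φ : W →ₗ[ℂ] ℂ}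
    (hφ : InGradedDual B.gr.proj φ) (g : B.gr.Comp) :
    ∃ D₀ : ℤ, ∀ K, B.compProdCoeff u g φ K ≠ 0 → D₀ ≤ ∑ i, K i := by
  obtain ⟨D₀, hD, -⟩ := B.exists_prod_bound u hφ
  refine ⟨D₀, fun K hK => ?_⟩
  obtain ⟨w, hw, -⟩ := B.exists_truncate u hφ g (∑ i, K i)
  rw [compProdCoeff, hw K rfl] at hK
  exact hD K w hK

theorem compIterCoeff_tail_bound (B : Bimod A W) {m : ℕ} (u : Fin m → V) {φ : W →ₗ[ℂ] ℂ}
    (hφ : InGradedDual B.gr.proj φ) (g : B.gr.Comp) :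
    ∃ N : ℤ, ∀ Q, B.compIterCoeff u g φ Q ≠ 0 → ∀ r : Fin m, N ≤ tail r.succ (expEquiv m Q) := by
  obtain ⟨N, hN⟩ := B.iterCoeff_tail_bound u
  refine ⟨N, fun Q hQ r => ?_⟩
  obtain ⟨w, -, hw⟩ := B.exists_truncate u hφ g (∑ i, Q.1 i + Q.2 + 1)
  rw [compIterCoeff, hw Q.1 Q.2 rfl] at hQ
  rw [tail_succ]
  exact hN w φ Q hQ r

theorem conf_append {m n : ℕ} {zo : Fin m → ℂ} {zt : Fin n → ℂ} (ho : Ordered zo) (ht : Conf zt)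
    (hot : ∀ i j, ‖zt j‖ < ‖zo i‖) : Conf (Fin.append zo zt) := by
  intro i j hij
  induction i using Fin.addCases with
  | left i =>
    induction j using Fin.addCases with
    | left j =>
      simp only [Fin.append_left]
      intro h
      rcases lt_trichotomy i j with hlt | rfl | hlt
      · exact (ho i j hlt).ne (by rw [h])
      · exact hij rfl
      · exact (ho j i hlt).ne (by rw [h])
    | right j =>
      simp only [Fin.append_left, Fin.append_right]
      intro h
      exact (hot i j).ne (by rw [h])
  | right i =>
    induction j using Fin.addCases with
    | left j =>
      simp only [Fin.append_left, Fin.append_right]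
      intro h
      exact (hot j i).ne (by rw [h])
    | right j =>
      simp only [Fin.append_right]
      exact ht i j fun h => hij (by rw [h])

/-- If the products applied to an element of the completion converge to a rational function, then so
do the iterates. -/
theorem hasSum_iterate (B : Bimod A W) {m n : ℕ} (u : Fin m → V) {φ : W →ₗ[ℂ] ℂ}
    (hφ : InGradedDual B.gr.proj φ) (g : B.gr.Comp) {zt : Fin n → ℂ} (hzt : Conf zt)
    (R : DiagRatFn (Fin (m + n)))
    (hconv : ∀ zo : Fin m → ℂ, Conf (Fin.append zo zt) → Ordered zo →
      (∀ i j, ‖zt j‖ < ‖zo i‖) →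
      HasSum (fun K => B.compProdCoeff u g φ K * ∏ i, zo i ^ (-K i - 1))
        (R.eval (Fin.append zo zt)))
    {τ : Fin (m + 1) → ℂ} (hτ : Ordered (Fin.tail τ))
    (hτ' : ∀ (i : Fin m) (j : Fin n), ‖τ i.succ‖ + ‖zt j‖ < ‖τ 0‖) :
    HasSum (fun Q => B.compIterCoeff u g φ Q * ∏ i, τ i ^ expEquiv m Q i)
      (R.eval (Fin.append (fun i => τ 0 + τ i.succ) zt)) := by
  classical
  obtain ⟨κ, α, E, hB, hS⟩ := expandable_diag m n R zt
  obtain ⟨N₀, hN₀⟩ := hB _ (Or.inl rfl)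
  obtain ⟨N₁, hN₁⟩ := exists_uniform_bound (g := fun (r : Fin m) k => tail r.succ (E k))
    fun r => hB _ (Or.inr ⟨r, rfl⟩)
  obtain ⟨D₀, hD₀⟩ := B.compProdCoeff_bound u hφ g
  obtain ⟨N₂, hN₂⟩ := B.compIterCoeff_tail_bound u hφ g
  have level : ∀ (D : ℤ) (y : Fin (m + 1) → ℝ), StrictAnti y → (∀ i, 0 < y i) → ∃ v,
      HasSum (fun Q => (if -tail 0 (expEquiv m Q) = D + m then B.compIterCoeff u g φ Q else 0) *
        ∏ i, (y i : ℂ) ^ expEquiv m Q i) v ∧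
      HasSum (fun k => (if -tail 0 (E k) = D + m then α k else 0) *
        ∏ i, (y i : ℂ) ^ E k i) v := by
    intro D y hy hpos
    have hsmall : ∀ᶠ s : ℝ in 𝓝[>] 0, ∀ (i : Fin m) (j : Fin n),
        s * ‖zt j‖ < y 0 - y i.succ := by
      refine eventually_all.mpr fun i => eventually_all.mpr fun j => ?_
      have hc : Tendsto (fun s : ℝ => s * ‖zt j‖) (𝓝[>] 0) (𝓝 (0 * ‖zt j‖)) :=
        ((continuous_mul_const _).tendsto 0).mono_left nhdsWithin_le_nhds
      rw [zero_mul] at hc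
      exact hc.eventually (gt_mem_nhds (sub_pos.mpr (hy (Fin.succ_pos i))))
    obtain ⟨v, hv₁, hv₂⟩ := exists_hasSum_slice
      (fun K => B.compProdCoeff u g φ K * ∏ i, ((y 0 : ℂ) + y i.succ) ^ (-K i - 1))
      (fun K => ∑ i, K i + (m : ℤ)) (fun k => α k * ∏ i, (y i : ℂ) ^ E k i)
      (fun k => -tail 0 (E k))
      ⟨D₀ + m, fun K hK => by
        have := hD₀ K (left_ne_zero_of_mul hK)
        linarith⟩ ⟨N₀, fun k _ => hN₀ k⟩ (by
        filter_upwards [hsmall, self_mem_nhdsWithin] with s hs hs0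
        have hs0 : 0 < s := hs0
        have hposd : ∀ i, 0 < y i / s := fun i => div_pos (hpos i) hs0
        have hanti : ∀ i j, i < j → y j / s < y i / s := fun i j hij =>
          div_lt_div_of_pos_right (hy hij) hs0
        have hdist : ∀ (i : Fin m) (j : Fin n), y i.succ / s + ‖zt j‖ < y 0 / s := fun i j => by
          rw [← lt_sub_iff_add_lt', ← sub_div, lt_div_iff₀ hs0, mul_comm]
          exact hs i j
        have hnorm : ∀ i : Fin m, ‖((y 0 / s : ℝ) : ℂ) + ((y i.succ / s : ℝ) : ℂ)‖ =
            y 0 / s + y i.succ / s := fun i => by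
          rw [← Complex.ofReal_add, norm_ofReal_of_pos (add_pos (hposd _) (hposd _))]
        have hord : Ordered fun i : Fin m =>
            ((y 0 / s : ℝ) : ℂ) + ((y i.succ / s : ℝ) : ℂ) := fun i j hij => by
          rw [hnorm, hnorm]
          linarith [hanti _ _ (Fin.succ_lt_succ_iff.mpr hij)]
        have hfar : ∀ (i : Fin m) (j : Fin n), ‖zt j‖ <
            ‖((y 0 / s : ℝ) : ℂ) + ((y i.succ / s : ℝ) : ℂ)‖ := fun i j => by
          rw [hnorm]
          linarith [hdist i j, hposd i.succ]
        have h1 := hconv _ (conf_append hord hzt hfar) hord hfar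
        have h2 := (hS (fun i => ((y i / s : ℝ) : ℂ)) ⟨fun i j hij => by
          simpa only [Fin.tail, norm_ofReal_of_pos (hposd _)] using
            hanti _ _ (Fin.succ_lt_succ_iff.mpr hij), fun i j => by
          simpa only [norm_ofReal_of_pos (hposd _)] using hdist i j⟩).2
        refine ⟨_, HasSum.of_eq h1 fun K => ?_, HasSum.of_eq h2 fun k => ?_⟩
        · rw [prod_terms y hs0.ne', mul_assoc]
        · rw [monomial_terms y hs0.ne', mul_assoc]) (D + m)
    obtain ⟨v', hv'₁, hv'₂⟩ := B.level_slice u hφ g D hy hpos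
    obtain rfl := hv₁.unique hv'₁
    refine ⟨v, HasSum.of_eq hv'₂ fun Q => ?_, HasSum.of_eq hv₂ fun k => ?_⟩
    · rw [ite_mul, zero_mul]
    · rw [ite_mul, zero_mul]
  have fiber : ∀ Q, HasSum (fun k => if E k = expEquiv m Q then α k else 0)
      (B.compIterCoeff u g φ Q) := by
    intro Q
    set D : ℤ := -tail 0 (expEquiv m Q) - m with hD
    have hbound : ∀ (N : ℤ) (e : Fin (m + 1) → ℤ), -tail 0 e = D + m →
        (∀ r : Fin m, N ≤ tail r.succ e) → ∀ r, min N (-(D + m)) ≤ tail r e := by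
      intro N e he h r
      induction r using Fin.cases with
      | zero => exact (min_le_right _ _).trans (by linarith)
      | succ r => exact (min_le_left _ _).trans (h r)
    have key := hasSum_fibers_of_multislice (expEquiv m)
      (c := fun Q => if -tail 0 (expEquiv m Q) = D + m then B.compIterCoeff u g φ Q else 0)
      (α := fun k => if -tail 0 (E k) = D + m then α k else 0) (E := E)
      ⟨_, fun Q hQ => by
        rw [ite_ne_right_iff] at hQ
        exact hbound N₂ _ hQ.1 (hN₂ Q hQ.2)⟩
      ⟨_, fun k hk => by
        rw [ite_ne_right_iff] at hk
        exact hbound N₁ _ hk.1 fun r => hN₁ r k⟩ 1 one_pos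
      (fun x hx hanti => level D x hanti fun i => (hx i).1) Q
    have hQ : -tail 0 (expEquiv m Q) = D + m := by rw [hD]; ring
    simp only [if_pos hQ] at key
    refine HasSum.of_eq key fun k => ?_
    split_ifs with h1 h2
    · rfl
    · exact absurd (h1 ▸ hQ) h2
    · rfl
  exact hasSum_of_fibers (expEquiv m) fiber (hS τ ⟨hτ, hτ'⟩).2

end Bimod

end

end Iterates



/-- Let `V` be a MOSVA and `W` a `V`-bimodule, both satisfying the
pole-order condition. Let `u₁,…,u_m ∈ V` and `f ∈ W̃_{z_{m+1},…,z_{m+n}}` be such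
that `Y_W^L(u₁,z₁)⋯Y_W^L(u_m,z_m)f(z_{m+1},…,z_{m+n})` converges absolutely to the
`W̄`-valued rational function `h` whenever `|z₁| > ⋯ > |z_m| > |z_i|`. Then
`Y_W^L(Y_V(u₁,z₁−ζ)⋯Y_V(u_m,z_m−ζ)𝟏, ζ)f(z_{m+1},…,z_{m+n})` also converges
absolutely to the same `W̄`-valued rational function whenever
`|ζ| > |z₁−ζ| + |z_i|` and `|z₁−ζ| > ⋯ > |z_m−ζ|` (so that the corresponding
`E(⋯)`'s agree as elements of `W̃_{z₁,…,z_{m+n}}`). -/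
theorem statement12 {V : Type*} [AddCommGroup V] [Module ℂ V]
    {W : Type*} [AddCommGroup W] [Module ℂ W]
    (A : MOSVA V) (B : Bimod A W) (hA : A.PoleOrder) (hB : B.PoleOrder)
    (m n : ℕ) (hm : 0 < m) (u : Fin m → V)
    (f : (Fin n → ℂ) → B.gr.Comp) (hfW : B.gr.WTilde f)
    (h : (Fin (m+n) → ℂ) → B.gr.Comp) (hhW : B.gr.WTilde h)
    (hconv : ∀ (zo : Fin m → ℂ) (zt : Fin n → ℂ), Conf (Fin.append zo zt) →
      Ordered zo → (∀ (i : Fin m) (j : Fin n), ‖zt j‖ < ‖zo i‖) →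
      ∀ φ : W →ₗ[ℂ] ℂ, InGradedDual B.gr.proj φ →
        AbsConvTo (fun K : Fin m → ℤ =>
            B.gr.pair φ (compApply m
                (fun i => B.gr.ext (fun x => B.YL (u i) x (K i))) (f zt))
              * ∏ i, zo i ^ (-(K i) - 1))
          (B.gr.pair φ (h (Fin.append zo zt)))) :
    ∀ (zo : Fin m → ℂ) (zt : Fin n → ℂ) (ζ : ℂ), Conf (Fin.append zo zt) →
      (∀ j : Fin n, ‖zo ⟨0, hm⟩ - ζ‖ + ‖zt j‖ < ‖ζ‖) →
      Ordered (fun i => zo i - ζ) →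
      ∀ φ : W →ₗ[ℂ] ℂ, InGradedDual B.gr.proj φ →
        AbsConvTo (fun K : (Fin m → ℤ) × ℤ =>
            B.gr.pair φ (B.gr.ext (fun x =>
                B.YL (compApply m (fun i y => A.Y (u i) y (K.1 i)) A.vac) x K.2) (f zt))
              * ζ ^ (-K.2 - 1) * ∏ i, (zo i - ζ) ^ (-(K.1 i) - 1))
          (B.gr.pair φ (h (Fin.append zo zt))) := by
  intro zo zt ζ hc hζ hord φ hφ
  obtain ⟨R, hR⟩ := hhW.1 φ hφ
  rw [absConvTo_iff, hR _ hc]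
  have hzt : Conf zt := fun i j hij => by
    simpa using hc (Fin.natAdd m i) (Fin.natAdd m j) (by simpa using hij)
  have hconv' := fun zo' hc' ho hlt => hR _ hc' ▸ absConvTo_iff.mp (hconv zo' zt hc' ho hlt φ hφ)
  have hτ' : ∀ (i : Fin m) (j : Fin n), ‖zo i - ζ‖ + ‖zt j‖ < ‖ζ‖ := fun i j => by
    have hle : ‖zo i - ζ‖ ≤ ‖zo ⟨0, hm⟩ - ζ‖ := by
      rcases Nat.eq_zero_or_pos i.1 with h0 | h0
      · rw [show i = ⟨0, hm⟩ from Fin.ext h0]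
      · exact (hord ⟨0, hm⟩ i h0).le
    linarith [hζ j]
  have key := B.hasSum_iterate u hφ (f zt) hzt R hconv'
    (τ := Fin.cons ζ fun i => zo i - ζ) (by simpa [Fin.tail] using hord) (by simpa using hτ')
  simp only [Fin.cons_zero, Fin.cons_succ, add_sub_cancel] at key
  refine HasSum.of_eq key fun Q => ?_
  rw [Fin.prod_univ_succ, ← mul_assoc]
  rfl

end VA
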